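/- arXiv:1107.1670 — 3 statements merged into one kernel-verified Lean document; each statement's English description precedes it below -/
import Mathlib

section
/- Let E and F be Banach spaces, 1 ≤ p < ∞, and P : E → F a continuous m-homogeneous polynomial. Then P is p-compact if and only if its transpose P′ : F′ → P(^mE), defined by P′(y′) = y′ ∘ P, is a quasi p-nuclear linear operator; moreover κ_p(P) = ν_p^Q(P′). -/
open scoped ENNReal NNReal Classical
open Filter Metric

noncomputable section

/-- Membership in the closed unit ball of `ℓ_q`, where `q` is the conjugate exponent of `p`
(`q = ∞`, i.e. bounded coefficients, when `p = 1`). -/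
def ConjUnitBall (p : ℝ) (α : ℕ → ℂ) : Prop :=
  if p = 1 then ∀ n, ‖α n‖ ≤ 1
  else (Summable fun n => ‖α n‖ ^ (p / (p - 1))) ∧ (∑' n, ‖α n‖ ^ (p / (p - 1))) ≤ 1

variable {E F : Type*} [NormedAddCommGroup E] [NormedSpace ℂ E]
  [NormedAddCommGroup F] [NormedSpace ℂ F]

/-- The `p`-convex hull `p-co{x_n}` of a sequence `(x_n)`. -/
def pCo (p : ℝ) (x : ℕ → F) : Set F :=
  {y | ∃ α : ℕ → ℂ, ConjUnitBall p α ∧ HasSum (fun n => α n • x n) y}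

/-- A set is relatively `p`-compact if it is contained in the `p`-convex hull of a
`p`-summable sequence. -/
def IsRelPCompact (p : ℝ) (K : Set F) : Prop :=
  ∃ x : ℕ → F, (Summable fun n => ‖x n‖ ^ p) ∧ K ⊆ pCo p x

/-- The measure of `p`-compactness `m_p(K)`. -/
def mP (p : ℝ) (K : Set F) : ℝ :=
  sInf {r : ℝ | ∃ x : ℕ → F, (Summable fun n => ‖x n‖ ^ p) ∧ K ⊆ pCo p x ∧
    r = (∑' n, ‖x n‖ ^ p) ^ (1 / p)}

/-- `m_p(K)` as an element of `[0, ∞]`; it equals `∞` when `K` is not relatively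
`p`-compact. -/
def mPE (p : ℝ) (K : Set F) : ℝ≥0∞ :=
  sInf {r : ℝ≥0∞ | ∃ x : ℕ → F, (Summable fun n => ‖x n‖ ^ p) ∧ K ⊆ pCo p x ∧
    r = ENNReal.ofReal ((∑' n, ‖x n‖ ^ p) ^ (1 / p))}

/-- The `m`-homogeneous polynomial `P_m f(x₀)` in the Taylor series expansion of `f` at `x₀`. -/
def taylorPoly (f : E → F) (x₀ : E) (m : ℕ) (x : E) : F :=
  ((m.factorial : ℂ))⁻¹ • iteratedFDeriv ℂ m f x₀ fun _ => x

/-- `f` is `p`-compact at `x₀` if some neighborhood of `x₀` has relatively `p`-compact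
image under `f`. -/
def PCompactAt (p : ℝ) (f : E → F) (x₀ : E) : Prop :=
  ∃ V ∈ nhds x₀, IsRelPCompact p (f '' V)

/-- The radius of `p`-compact convergence of `f` at `x₀`:
`r_p(f, x₀) = 1 / limsup κ_p(P_mf(x₀))^{1/m}` (with the conventions `1/0 = ∞`, and
`κ_p(P) = ∞` when `P` is not `p`-compact, so that `r_p(f,x₀) = 0` in that case). -/
def pRadius (p : ℝ) (f : E → F) (x₀ : E) : ℝ≥0∞ :=
  (Filter.limsup (fun m : ℕ => (mPE p (taylorPoly f x₀ m '' closedBall 0 1)) ^ (1 / (m : ℝ)))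
    Filter.atTop)⁻¹

/-- The `m`-homogeneous polynomial associated to a continuous `m`-linear map. -/
def polyEval {m : ℕ} (A : ContinuousMultilinearMap ℂ (fun _ : Fin m => E) F) (x : E) : F :=
  A fun _ => x

/-- The norm of `P'(y') = y' ∘ P` in `P(^mE)`, i.e. the supremum of `‖y'(P x)‖` over the
closed unit ball of `E`. -/
def dualSupNorm {m : ℕ} (A : ContinuousMultilinearMap ℂ (fun _ : Fin m => E) F)
    (y' : F →L[ℂ] ℂ) : ℝ :=
  sSup {r : ℝ | ∃ x ∈ closedBall (0 : E) 1, r = ‖y' (polyEval A x)‖}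

/-- A sequence `φ = (φ_n)` in `F'' = (F')'` witnessing quasi `p`-nuclearity of the
transpose `P' : F' → P(^mE)`:  `∑ ‖φ_n‖^p < ∞` and
`‖P'(y')‖ ≤ (∑_n ‖φ_n(y')‖^p)^{1/p}` for every `y' ∈ F'`. -/
def QuasiPNuclearWitness (p : ℝ) {m : ℕ}
    (A : ContinuousMultilinearMap ℂ (fun _ : Fin m => E) F)
    (φ : ℕ → (F →L[ℂ] ℂ) →L[ℂ] ℂ) : Prop :=
  (Summable fun n => ‖φ n‖ ^ p) ∧
  ∀ y' : F →L[ℂ] ℂ, dualSupNorm A y' ≤ (∑' n, ‖φ n y'‖ ^ p) ^ (1 / p)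

/-- `α` acts on the finitely supported vectors of `ℓ_p(κ)` as a functional of norm at most `r`,
i.e. `α` lies in the ball of radius `r` of `ℓ_q(κ)`. -/
def CoefBound {κ : Type*} (p r : ℝ) (α : κ → ℂ) : Prop :=
  ∀ (s : Finset κ) (b : κ → ℝ), (∀ i, 0 ≤ b i) →
    ∑ i ∈ s, ‖α i‖ * b i ≤ r * (∑ i ∈ s, b i ^ p) ^ (1 / p)

/-- All finite partial sums of `∑ ‖x_i‖^p` are at most `C^p`. -/
def SeqBound {κ G : Type*} [Norm G] (p C : ℝ) (x : κ → G) : Prop :=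
  ∀ s : Finset κ, ∑ i ∈ s, ‖x i‖ ^ p ≤ C ^ p

/-- The family `k` takes its values in `p-co{x_n}` for a sequence with `‖(x_n)‖_p ≤ C`. -/
def PBound {T : Type*} (p C : ℝ) (k : T → F) : Prop :=
  ∃ x : ℕ → F, SeqBound p C x ∧
    ∀ t, ∃ α : ℕ → ℂ, CoefBound p 1 α ∧ HasSum (fun n => α n • x n) (k t)

lemma conjUnitBall_iff {p : ℝ} (hp : 1 ≤ p) (α : ℕ → ℂ) :
    ConjUnitBall p α ↔ CoefBound p 1 α := by
  unfold ConjUnitBall CoefBound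
  split_ifs with h
  · subst h
    constructor
    · intro h s b hb
      simp only [Real.rpow_one, div_one, one_mul]
      exact Finset.sum_le_sum fun i _ => mul_le_of_le_one_left (hb i) (h i)
    · intro h n
      simpa using h {n} (fun _ => 1) (fun _ => zero_le_one)
  · have hp1 : 1 < p := lt_of_le_of_ne hp (Ne.symm h)
    have hpq : p.HolderConjugate (p / (p - 1)) := Real.HolderConjugate.conjExponent hp1
    set q := p / (p - 1) with hq
    constructor
    · rintro ⟨hs, hle⟩ s b hb
      have h1 := Real.inner_le_Lp_mul_Lq s (fun i => ‖α i‖) b hpq.symm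
      simp only [abs_norm, abs_of_nonneg (hb _)] at h1
      refine h1.trans ?_
      refine mul_le_mul_of_nonneg_right (Real.rpow_le_one (by positivity) ?_
        (by have := hpq.symm.pos; positivity))
        (Real.rpow_nonneg (Finset.sum_nonneg fun i _ => Real.rpow_nonneg (hb i) _) _)
      exact (hs.sum_le_tsum s (fun i _ => by positivity)).trans hle
    · intro h
      have hq1 : 1 < q := hpq.symm.lt
      have key : ∀ s : Finset ℕ, ∑ i ∈ s, ‖α i‖ ^ q ≤ 1 := by
        intro s
        have h1 := h s (fun i => ‖α i‖ ^ (q - 1)) (fun i => by positivity)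
        have h2 : ∀ i, ‖α i‖ * ‖α i‖ ^ (q - 1) = ‖α i‖ ^ q := fun i => by
          rw [← Real.rpow_one_add' (norm_nonneg _) (by linarith)]; congr 1; ring
        have h3 : ∀ i, (‖α i‖ ^ (q - 1)) ^ p = ‖α i‖ ^ q := fun i => by
          rw [← Real.rpow_mul (norm_nonneg _), mul_comm, mul_sub, mul_one, mul_comm,
            hpq.symm.mul_eq_add]; congr 1; ring
        simp only [h2, h3, one_mul] at h1
        by_contra! hc
        refine absurd h1 (not_le.2 ?_)
        have := Real.rpow_lt_rpow_of_exponent_lt hc (y := 1 / p) (z := 1)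
          (by rw [div_lt_one (by linarith)]; exact hp1)
        rwa [Real.rpow_one] at this
      have hs := summable_of_sum_le (fun i => by positivity) key
      exact ⟨hs, hs.tsum_le_of_sum_le key⟩

namespace SeqBound

variable {κ G : Type*}

lemma of_summable [NormedAddCommGroup G] {p : ℝ} (hp : 1 ≤ p) {x : κ → G}
    (hx : Summable fun n => ‖x n‖ ^ p) :
    SeqBound p ((∑' n, ‖x n‖ ^ p) ^ (1 / p)) x := by
  intro s
  rw [← Real.rpow_mul (tsum_nonneg fun _ => by positivity), one_div,
    inv_mul_cancel₀ (by linarith), Real.rpow_one]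
  exact hx.sum_le_tsum s fun i _ => by positivity

lemma summable [NormedAddCommGroup G] {p C : ℝ} {x : κ → G} (hx : SeqBound p C x) :
    Summable fun n => ‖x n‖ ^ p :=
  summable_of_sum_le (fun i => by positivity) hx

lemma tsum_le [NormedAddCommGroup G] {p C : ℝ} (hp : 1 ≤ p) (hC : 0 ≤ C) {x : κ → G}
    (hx : SeqBound p C x) : (∑' n, ‖x n‖ ^ p) ^ (1 / p) ≤ C := by
  rw [one_div, Real.rpow_inv_le_iff_of_pos (tsum_nonneg fun _ => by positivity) hC (by linarith)]
  exact hx.summable.tsum_le_of_sum_le hx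

lemma mono [Norm G] {p C C' : ℝ} (hp : 1 ≤ p) (hC : 0 ≤ C) (h : C ≤ C') {x : κ → G}
    (hx : SeqBound p C x) : SeqBound p C' x := fun s =>
  (hx s).trans (Real.rpow_le_rpow hC h (by linarith))

end SeqBound

lemma CoefBound.sum_le {κ G : Type*} [NormedAddCommGroup G] {p r C : ℝ} (hp : 1 ≤ p)
    (hr : 0 ≤ r) (hC : 0 ≤ C) {α : κ → ℂ} (hα : CoefBound p r α) {x : κ → G}
    (hx : SeqBound p C x) (s : Finset κ) : ∑ i ∈ s, ‖α i‖ * ‖x i‖ ≤ r * C := by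
  refine (hα s (fun i => ‖x i‖) fun i => norm_nonneg _).trans ?_
  gcongr
  rw [one_div, Real.rpow_inv_le_iff_of_pos (Finset.sum_nonneg fun _ _ => by positivity) hC
    (by linarith)]
  exact hx s

lemma CoefBound.summable {κ G : Type*} [NormedAddCommGroup G] {p r C : ℝ} (hp : 1 ≤ p)
    (hr : 0 ≤ r) (hC : 0 ≤ C) {α : κ → ℂ} (hα : CoefBound p r α) {x : κ → G}
    (hx : SeqBound p C x) : Summable fun i => ‖α i‖ * ‖x i‖ :=
  summable_of_sum_le (fun i => by positivity) (hα.sum_le hp hr hC hx)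

/-- Any countable index set may be used in the definition of `PBound`. -/
lemma PBound.of_countable {κ T : Type*} [Countable κ] {p C : ℝ} (hp : 1 ≤ p) {k : T → F}
    (x : κ → F) (hx : SeqBound p C x)
    (h : ∀ t, ∃ α : κ → ℂ, CoefBound p 1 α ∧ HasSum (fun n => α n • x n) (k t)) :
    PBound p C k := by
  obtain ⟨f, hf⟩ := exists_injective_nat κ
  have hp0 : p ≠ 0 := by linarith
  refine ⟨Function.extend f x 0, fun s => ?_, fun t => ?_⟩
  · rw [← Finset.sum_preimage f s hf.injOn (fun n => ‖Function.extend f x 0 n‖ ^ p)]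
    · simpa only [hf.extend_apply] using hx _
    · intro n _ hn
      rw [Function.extend_apply' _ _ _ (by simpa using hn)]
      simp [hp0]
  · obtain ⟨α, hα, hs⟩ := h t
    refine ⟨Function.extend f α 0, fun s b hb => ?_, ?_⟩
    · rw [← Finset.sum_preimage f s hf.injOn (fun n => ‖Function.extend f α 0 n‖ * b n)]
      · simp only [hf.extend_apply]
        refine (hα _ (fun i => b (f i)) fun i => hb _).trans ?_
        have h1 : ∑ i ∈ s.preimage f hf.injOn, b (f i) ^ p ≤ ∑ i ∈ s, b i ^ p := by
          rw [← Finset.sum_image (f := fun n => b n ^ p) (g := f) (fun a _ c _ h => hf h)]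
          refine Finset.sum_le_sum_of_subset_of_nonneg (fun n hn => ?_)
            (fun i _ _ => Real.rpow_nonneg (hb i) _)
          obtain ⟨i, hi, rfl⟩ := Finset.mem_image.1 hn
          exact Finset.mem_preimage.1 hi
        have h2 : 0 ≤ ∑ i ∈ s.preimage f hf.injOn, b (f i) ^ p :=
          Finset.sum_nonneg fun i _ => Real.rpow_nonneg (hb _) _
        gcongr
      · intro n _ hn
        rw [Function.extend_apply' _ _ _ (by simpa using hn)]
        simp
    · rw [← hasSum_extend_zero hf] at hs
      convert hs using 2 with n
      by_cases hn : ∃ i, f i = n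
      · obtain ⟨i, rfl⟩ := hn
        simp [hf.extend_apply]
      · simp [Function.extend_apply' _ _ _ hn]

lemma PBound.comp {T T' : Type*} {p C : ℝ} {k : T → F} (hk : PBound p C k) (f : T' → T) :
    PBound p C (k ∘ f) := by
  obtain ⟨x, hx, h⟩ := hk
  exact ⟨x, hx, fun t => h (f t)⟩

lemma sum_fiberwise_preimage {ι κ : Type*} (s : Finset (ι × κ)) (g : ι × κ → ℝ) :
    ∑ z ∈ s, g z = ∑ i ∈ s.image Prod.fst,
      ∑ n ∈ s.preimage (Prod.mk i) (Prod.mk_right_injective i).injOn, g (i, n) := by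
  apply Finset.sum_finset_product
  rintro ⟨i, n⟩
  simp only [Finset.mem_image, Finset.mem_preimage, Prod.exists, exists_and_right, exists_eq_right]
  exact ⟨fun h => ⟨⟨n, h⟩, h⟩, fun h => h.2⟩

/-- Countable subadditivity of the measure of `p`-compactness. -/
lemma PBound.hasSum {ι T : Type*} [Countable ι] [Nonempty ι] [CompleteSpace F] {p : ℝ}
    (hp : 1 ≤ p) {f : ι → T → F} {c : ι → ℝ} {S : ℝ} (hc : ∀ i, 0 < c i) (hS : HasSum c S)
    (hf : ∀ i, PBound p (c i) (f i)) {k : T → F} (hk : ∀ t, HasSum (fun i => f i t) (k t)) :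
    PBound p S k := by
  have hp0 : 0 < p := by linarith
  choose x hx α hα hsum using hf
  have hS0 : 0 < S := by
    obtain ⟨i⟩ := ‹Nonempty ι›
    exact (hc i).trans_le (le_hasSum hS i fun j _ => (hc j).le)
  obtain ⟨l, hl⟩ : ∃ l : ι → ℝ, l = fun i => c i / S := ⟨_, rfl⟩
  have hl0 : ∀ i, 0 < l i := fun i => by rw [hl]; exact div_pos (hc i) hS0
  have hl1 : ∀ s : Finset ι, ∑ i ∈ s, l i ≤ 1 := fun s => by
    have := sum_le_hasSum s (fun i _ => (hc i).le) hS
    rw [hl, ← Finset.sum_div]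
    exact (div_le_one hS0).2 this
  have hcl : ∀ i, c i = l i * S := fun i => by rw [hl]; field_simp
  obtain ⟨μ, hμ⟩ : ∃ μ : ι → ℝ, μ = fun i => l i ^ (1 - p⁻¹) := ⟨_, rfl⟩
  have hμ0 : ∀ i, 0 < μ i := fun i => by rw [hμ]; exact Real.rpow_pos_of_pos (hl0 i) _
  have hXb : SeqBound p S fun z : ι × ℕ => ((μ z.1)⁻¹ : ℂ) • x z.1 z.2 := by
    intro s
    have hnorm : ∀ i n, ‖((μ i)⁻¹ : ℂ) • x i n‖ ^ p = (μ i)⁻¹ ^ p * ‖x i n‖ ^ p := fun i n => by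
      rw [norm_smul, Real.mul_rpow (norm_nonneg _) (norm_nonneg _), norm_inv, Complex.norm_real,
        Real.norm_of_nonneg (hμ0 _).le]
    have hμc : ∀ i, (μ i)⁻¹ ^ p * c i ^ p = l i * S ^ p := fun i => by
      have h1 : (μ i)⁻¹ ^ p = l i ^ (1 - p) := by
        rw [hμ, ← Real.rpow_neg (hl0 i).le, ← Real.rpow_mul (hl0 i).le]
        congr 1
        field_simp
        ring
      rw [h1, hcl, Real.mul_rpow (hl0 i).le hS0.le, ← mul_assoc, ← Real.rpow_add (hl0 i)]
      simp
    rw [sum_fiberwise_preimage]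
    calc _ ≤ ∑ i ∈ s.image Prod.fst, l i * S ^ p := by
          refine Finset.sum_le_sum fun i _ => ?_
          simp only [hnorm]
          rw [← hμc, ← Finset.mul_sum]
          exact mul_le_mul_of_nonneg_left (hx i _)
            (Real.rpow_nonneg (inv_nonneg.2 (hμ0 i).le) _)
      _ ≤ S ^ p := by
          rw [← Finset.sum_mul]
          exact mul_le_of_le_one_left (by positivity) (hl1 _)
  have hcoef : ∀ t, CoefBound p 1 fun z : ι × ℕ => (μ z.1 : ℂ) * α z.1 t z.2 := by
    intro t s b hb
    obtain ⟨I, hI⟩ : ∃ I, I = s.image Prod.fst := ⟨_, rfl⟩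
    obtain ⟨N, hN⟩ : ∃ N : ι → Finset ℕ,
      N = fun i => s.preimage (Prod.mk i) (Prod.mk_right_injective i).injOn := ⟨_, rfl⟩
    have hsplit : ∀ g : ι × ℕ → ℝ, ∑ z ∈ s, g z = ∑ i ∈ I, ∑ n ∈ N i, g (i, n) := fun g => by
      rw [hI, hN]; exact sum_fiberwise_preimage s g
    have hB0 : ∀ i, 0 ≤ ∑ n ∈ N i, b (i, n) ^ p := fun i =>
      Finset.sum_nonneg fun n _ => Real.rpow_nonneg (hb _) _
    have hw : ∀ i, l i * (l i ^ (-p⁻¹) * (∑ n ∈ N i, b (i, n) ^ p) ^ (1 / p)) =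
        μ i * (∑ n ∈ N i, b (i, n) ^ p) ^ (1 / p) := fun i => by
      rw [← mul_assoc, hμ]
      congr 1
      nth_rewrite 1 [← Real.rpow_one (l i)]
      rw [← Real.rpow_add (hl0 i), ← sub_eq_add_neg]
    have hwp : ∀ i, l i * (l i ^ (-p⁻¹) * (∑ n ∈ N i, b (i, n) ^ p) ^ (1 / p)) ^ p =
        ∑ n ∈ N i, b (i, n) ^ p := fun i => by
      rw [Real.mul_rpow (Real.rpow_nonneg (hl0 i).le _) (Real.rpow_nonneg (hB0 i) _),
        ← Real.rpow_mul (hl0 i).le, ← Real.rpow_mul (hB0 i), one_div, neg_mul,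
        inv_mul_cancel₀ hp0.ne', Real.rpow_neg_one, Real.rpow_one, ← mul_assoc,
        mul_inv_cancel₀ (hl0 i).ne', one_mul]
    have hJ := Real.inner_le_weight_mul_Lp_of_nonneg I hp l
      (fun i => l i ^ (-p⁻¹) * (∑ n ∈ N i, b (i, n) ^ p) ^ (1 / p)) (fun i => (hl0 i).le)
      (fun i => mul_nonneg (Real.rpow_nonneg (hl0 i).le _) (Real.rpow_nonneg (hB0 i) _))
    simp only [hw, hwp] at hJ
    rw [hsplit, hsplit, one_div]
    calc _ ≤ ∑ i ∈ I, μ i * (∑ n ∈ N i, b (i, n) ^ p) ^ (1 / p) := by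
          refine Finset.sum_le_sum fun i _ => ?_
          have := hα i t (N i) (fun n => b (i, n)) fun n => hb _
          rw [one_mul] at this
          simp only [norm_mul, Complex.norm_real, Real.norm_of_nonneg (hμ0 i).le, mul_assoc,
            ← Finset.mul_sum]
          exact mul_le_mul_of_nonneg_left this (hμ0 i).le
      _ ≤ _ := hJ
      _ ≤ _ := by
          refine mul_le_mul_of_nonneg_right (Real.rpow_le_one
            (Finset.sum_nonneg fun i _ => (hl0 i).le) (hl1 _) ?_)
            (Real.rpow_nonneg (Finset.sum_nonneg fun i _ => hB0 i) _)
          exact sub_nonneg.2 (inv_le_one_of_one_le₀ hp)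
  refine PBound.of_countable hp _ hXb fun t => ⟨_, hcoef t, ?_⟩
  have hs : Summable fun z : ι × ℕ =>
      ((μ z.1 : ℂ) * α z.1 t z.2) • ((μ z.1)⁻¹ : ℂ) • x z.1 z.2 := by
    refine Summable.of_norm ?_
    simpa only [norm_smul] using (hcoef t).summable hp zero_le_one hS0.le hXb
  have h2 : ∀ i, HasSum (fun n => ((μ i : ℂ) * α i t n) • ((μ i)⁻¹ : ℂ) • x i n) (f i t) :=
    fun i => by
      convert hsum i t using 2 with n
      have : (μ i : ℂ) ≠ 0 := by exact_mod_cast (hμ0 i).ne'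
      rw [smul_smul]
      congr 1
      field_simp
  rw [← (hs.hasSum.prod_fiberwise h2).unique (hk t)]
  exact hs.hasSum

/-- In the bidual of `F`, the vector `y` equals `∑ α_n φ_n` (weak-star), with `α` in the unit
ball of `ℓ_q`. -/
def BidualRep (p : ℝ) (φ : ℕ → (F →L[ℂ] ℂ) →L[ℂ] ℂ) (α : ℕ → ℂ) (y : F) : Prop :=
  CoefBound p 1 α ∧ ∀ y' : F →L[ℂ] ℂ, HasSum (fun n => α n * φ n y') (y' y)

lemma CoefBound.norm_le {κ : Type*} {p r : ℝ} {α : κ → ℂ} (hα : CoefBound p r α) (n : κ) :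
    ‖α n‖ ≤ r := by
  simpa using hα {n} (fun _ => 1) fun _ => zero_le_one

lemma CoefBound.sub {κ : Type*} {p r r' : ℝ} {α β : κ → ℂ} (hα : CoefBound p r α)
    (hβ : CoefBound p r' β) : CoefBound p (r + r') fun n => α n - β n := by
  intro s b hb
  rw [add_mul]
  refine le_trans ?_ (add_le_add (hα s b hb) (hβ s b hb))
  rw [← Finset.sum_add_distrib]
  refine Finset.sum_le_sum fun i _ => ?_
  rw [← add_mul]
  exact mul_le_mul_of_nonneg_right (norm_sub_le _ _) (hb i)

lemma BidualRep.norm_le {p C : ℝ} (hp : 1 ≤ p) (hC : 0 ≤ C)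
    {φ : ℕ → (F →L[ℂ] ℂ) →L[ℂ] ℂ} (hφ : SeqBound p C φ) {α : ℕ → ℂ} {y : F}
    (h : BidualRep p φ α y) : ‖y‖ ≤ C := by
  refine NormedSpace.norm_le_dual_bound ℂ y hC fun y' => ?_
  have hs := CoefBound.summable (G := (F →L[ℂ] ℂ) →L[ℂ] ℂ) (x := φ) hp zero_le_one hC h.1 hφ
  have he : ‖y' y‖ = ‖∑' n, α n * φ n y'‖ := congrArg _ (h.2 y').tsum_eq.symm
  refine he.trans_le ?_
  have hle : ∀ n, ‖α n * φ n y'‖ ≤ ‖α n‖ * ‖φ n‖ * ‖y'‖ := fun n => by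
    rw [norm_mul, mul_assoc]
    exact mul_le_mul_of_nonneg_left ((φ n).le_opNorm y') (norm_nonneg _)
  refine (tsum_of_norm_bounded (hs.mul_right ‖y'‖).hasSum hle).trans ?_
  have hsC := hs.tsum_le_of_sum_le
    (CoefBound.sum_le (G := (F →L[ℂ] ℂ) →L[ℂ] ℂ) (x := φ) hp zero_le_one hC h.1 hφ)
  rw [one_mul] at hsC
  exact tsum_mul_right.trans_le (mul_le_mul_of_nonneg_right hsC (norm_nonneg _))

lemma lp_single_eq_smul {P : ℝ≥0∞} (i : ℕ) (c : ℂ) :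
    lp.single (E := fun _ : ℕ => ℂ) P i c = c • lp.single (E := fun _ : ℕ => ℂ) P i 1 := by
  rw [← lp.single_smul, smul_eq_mul, mul_one]

lemma coefBound_of_dual {p : ℝ} (hp : 1 ≤ p) [Fact (1 ≤ ENNReal.ofReal p)]
    (g : StrongDual ℂ (lp (fun _ : ℕ => ℂ) (ENNReal.ofReal p))) (hg : ‖g‖ ≤ 1) :
    CoefBound p 1 fun n => g (lp.single (ENNReal.ofReal p) n 1) := by
  have hp0 : 0 < p := by linarith
  have hpr : (ENNReal.ofReal p).toReal = p := ENNReal.toReal_ofReal hp0.le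
  intro s b hb
  choose c hc1 hc using fun n =>
    RCLike.exists_norm_eq_mul_self (g (lp.single (ENNReal.ofReal p) n 1))
  have hsum : ((∑ i ∈ s, ‖g (lp.single (ENNReal.ofReal p) i 1)‖ * b i : ℝ) : ℂ) =
      g (∑ i ∈ s, lp.single (ENNReal.ofReal p) i (c i * b i)) := by
    rw [map_sum, Complex.ofReal_sum]
    refine Finset.sum_congr rfl fun i _ => ?_
    rw [lp_single_eq_smul i (c i * b i), map_smul, Complex.ofReal_mul, smul_eq_mul]
    exact (congrArg (· * (b i : ℂ)) (hc i)).trans (mul_right_comm _ _ _)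
  have hn := lp.norm_sum_single (E := fun _ : ℕ => ℂ) (p := ENNReal.ofReal p)
    (by rw [hpr]; exact hp0) (fun i => c i * (b i : ℂ)) s
  have hcb : ∀ i, ‖c i * (b i : ℂ)‖ = b i := fun i => by
    rw [norm_mul, hc1, one_mul, Complex.norm_real, Real.norm_of_nonneg (hb i)]
  simp only [hpr, hcb] at hn
  rw [← hn, ← Real.rpow_mul (norm_nonneg _), mul_one_div_cancel hp0.ne', Real.rpow_one]
  refine le_trans ?_ (g.le_of_opNorm_le hg _)
  rw [← hsum, Complex.norm_real]
  exact Real.le_norm_self _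

/-- The operator `y' ↦ (φ_n(y'))` from the dual of `F` to `ℓ_p`. -/
def dualToLp {p : ℝ} (hp : 0 < p) {φ : ℕ → (F →L[ℂ] ℂ) →L[ℂ] ℂ}
    (hφ : Summable fun n => ‖φ n‖ ^ p) :
    (F →L[ℂ] ℂ) →ₗ[ℂ] lp (fun _ : ℕ => ℂ) (ENNReal.ofReal p) where
  toFun y' := ⟨fun n => φ n y', by
    apply memℓp_gen
    rw [ENNReal.toReal_ofReal hp.le]
    refine Summable.of_nonneg_of_le (fun n => by positivity) (fun n => ?_)
      (hφ.mul_right (‖y'‖ ^ p))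
    refine (Real.rpow_le_rpow (norm_nonneg _) ((φ n).le_opNorm y') hp.le).trans_eq ?_
    exact Real.mul_rpow (norm_nonneg _) (norm_nonneg _)⟩
  map_add' a b := by ext n; exact map_add (φ n) a b
  map_smul' c a := by ext n; exact map_smul (φ n) c a

lemma norm_dualToLp {p : ℝ} (hp : 0 < p) {φ : ℕ → (F →L[ℂ] ℂ) →L[ℂ] ℂ}
    (hφ : Summable fun n => ‖φ n‖ ^ p) (y' : F →L[ℂ] ℂ) :
    ‖dualToLp hp hφ y'‖ = (∑' n, ‖φ n y'‖ ^ p) ^ (1 / p) := by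
  have hpr : (ENNReal.ofReal p).toReal = p := ENNReal.toReal_ofReal hp.le
  rw [lp.norm_eq_tsum_rpow (by rw [hpr]; exact hp), hpr]
  rfl

/-- Hahn–Banach: a functional dominated by a linear map into a normed space factors through it. -/
lemma exists_dual_factor {V W : Type*} [AddCommGroup V] [Module ℂ V] [NormedAddCommGroup W]
    [NormedSpace ℂ W] (Φ : V →ₗ[ℂ] W) (ev : V →ₗ[ℂ] ℂ) (h : ∀ v, ‖ev v‖ ≤ ‖Φ v‖) :
    ∃ g : StrongDual ℂ W, ‖g‖ ≤ 1 ∧ ∀ v, g (Φ v) = ev v := by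
  have hev : ev ∈ LinearMap.range Φ.dualMap := by
    rw [LinearMap.range_dualMap_eq_dualAnnihilator_ker, Submodule.mem_dualAnnihilator]
    intro v hv
    have := h v
    rw [LinearMap.mem_ker.1 hv, norm_zero] at this
    exact norm_le_zero_iff.1 this
  obtain ⟨g₀, hg₀⟩ := hev
  have hg₀' : ∀ v, g₀ (Φ v) = ev v := fun v => LinearMap.congr_fun hg₀ v
  have hb : ∀ w : LinearMap.range Φ, ‖(g₀.comp (LinearMap.range Φ).subtype) w‖ ≤ 1 * ‖w‖ := by
    rintro ⟨_, v, rfl⟩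
    simpa [hg₀'] using h v
  obtain ⟨g, hg, hgn⟩ := exists_extension_norm_eq (LinearMap.range Φ)
    ((g₀.comp (LinearMap.range Φ).subtype).mkContinuous 1 hb)
  refine ⟨g, hgn.trans_le (LinearMap.mkContinuous_norm_le _ zero_le_one _), fun v => ?_⟩
  rw [hg ⟨Φ v, v, rfl⟩]
  exact hg₀' v

/-- A vector dominated by `(φ_n)` on the dual space lies in the `p`-convex hull of `(φ_n)` in the
bidual. -/
lemma exists_bidualRep {p : ℝ} (hp : 1 ≤ p) {φ : ℕ → (F →L[ℂ] ℂ) →L[ℂ] ℂ}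
    (hφ : Summable fun n => ‖φ n‖ ^ p) {y : F}
    (h : ∀ y' : F →L[ℂ] ℂ, ‖y' y‖ ≤ (∑' n, ‖φ n y'‖ ^ p) ^ (1 / p)) :
    ∃ α, BidualRep p φ α y := by
  have hp0 : 0 < p := by linarith
  have : Fact (1 ≤ ENNReal.ofReal p) := ⟨by simpa using ENNReal.ofReal_le_ofReal hp⟩
  obtain ⟨g, hg1, hg⟩ := exists_dual_factor (dualToLp hp0 hφ)
    (NormedSpace.inclusionInDoubleDual ℂ F y).toLinearMap
    fun y' => (h y').trans_eq (norm_dualToLp hp0 hφ y').symm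
  refine ⟨_, coefBound_of_dual hp g hg1, fun y' => ?_⟩
  have h1 := g.hasSum (lp.hasSum_single (E := fun _ : ℕ => ℂ) ENNReal.ofReal_ne_top
    (dualToLp hp0 hφ y'))
  rw [hg y'] at h1
  have e : ∀ n, g (lp.single (ENNReal.ofReal p) n 1) * φ n y' =
      g (lp.single (ENNReal.ofReal p) n (dualToLp hp0 hφ y' n)) := fun n => by
    rw [lp_single_eq_smul n (dualToLp hp0 hφ y' n), map_smul, smul_eq_mul, mul_comm]
    rfl
  simp only [e]
  exact h1

lemma exists_almost_norming (y' : F →L[ℂ] ℂ) {b η : ℝ} (hb : 0 ≤ b) (hη : 0 < η) :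
    ∃ x : F, ‖x‖ ≤ b ∧ b * ‖y'‖ - η ≤ (y' x).re := by
  rcases hb.eq_or_lt with rfl | hb
  · exact ⟨0, by simp, by simpa using hη.le⟩
  obtain ⟨x, hx, hr⟩ := y'.exists_lt_apply_of_lt_opNorm
    (show ‖y'‖ - η / b < ‖y'‖ from sub_lt_self _ (by positivity))
  obtain ⟨c, hc1, hc⟩ := RCLike.exists_norm_eq_mul_self (y' x)
  refine ⟨((b : ℂ) * c) • x, ?_, ?_⟩
  · rw [norm_smul, norm_mul, hc1, mul_one, Complex.norm_real, Real.norm_of_nonneg hb.le]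
    exact mul_le_of_le_one_right hb.le hx.le
  · have : y' (((b : ℂ) * c) • x) = ((b * ‖y' x‖ : ℝ) : ℂ) := by
      rw [map_smul, smul_eq_mul, mul_assoc, Complex.ofReal_mul]
      exact congrArg _ hc.symm
    rw [this, Complex.ofReal_re]
    have h2 := mul_le_mul_of_nonneg_left hr.le hb.le
    rwa [mul_sub, mul_div_cancel₀ _ hb.ne'] at h2

lemma PBound.of_finite {T : Type*} [Fintype T] {p ε : ℝ} (hp : 1 ≤ p) (hε : 0 ≤ ε) {e : T → F}
    (he : ∀ t, ‖e t‖ ≤ ε) : PBound p ((Fintype.card T + 1) * ε) e := by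
  have hp0 : 0 < p := by linarith
  refine PBound.of_countable hp e (fun s => ?_) fun t => ⟨Pi.single t 1, fun s b hb => ?_, ?_⟩
  · calc ∑ i ∈ s, ‖e i‖ ^ p ≤ ∑ _i ∈ s, ε ^ p :=
          Finset.sum_le_sum fun i _ => Real.rpow_le_rpow (norm_nonneg _) (he i) hp0.le
      _ = s.card * ε ^ p := by simp
      _ ≤ (Fintype.card T + 1 : ℝ) ^ p * ε ^ p := by
          refine mul_le_mul_of_nonneg_right ?_ (Real.rpow_nonneg hε _)
          calc (s.card : ℝ) ≤ Fintype.card T + 1 := by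
                have : (s.card : ℝ) ≤ Fintype.card T := by exact_mod_cast s.card_le_univ
                linarith
            _ ≤ _ := Real.self_le_rpow_of_one_le (by simp) hp
      _ = _ := (Real.mul_rpow (by positivity) hε).symm
  · have hnn : ∀ i, 0 ≤ b i ^ p := fun i => Real.rpow_nonneg (hb i) _
    rw [one_mul]
    by_cases ht : t ∈ s
    · rw [Finset.sum_eq_single_of_mem t ht fun i _ hi => by simp [hi]]
      rw [Pi.single_eq_same, norm_one, one_mul, one_div,
        Real.le_rpow_inv_iff_of_pos (hb t) (Finset.sum_nonneg fun i _ => hnn i) hp0]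
      exact Finset.single_le_sum (fun i _ => hnn i) ht
    · rw [Finset.sum_eq_zero fun i hi => by
        rw [Pi.single_eq_of_ne (ne_of_mem_of_not_mem hi ht)]; simp]
      exact Real.rpow_nonneg (Finset.sum_nonneg fun i _ => hnn i) _
  · convert hasSum_single t fun i hi => ?_ using 1
    · simp
    · simp [hi]

/-- A finite family represented by `(φ_n)` in the bidual is approximated in norm by families
represented in `F` by sequences dominated by `(‖φ_n‖)`. -/
lemma mem_closure_of_bidualRep {T : Type*} [Fintype T] {p : ℝ}
    {φ : ℕ → (F →L[ℂ] ℂ) →L[ℂ] ℂ} {α : T → ℕ → ℂ} {k : T → F}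
    (h : ∀ t, BidualRep p φ (α t) (k t)) :
    k ∈ closure {z : T → F | ∃ x : ℕ → F, (∀ n, ‖x n‖ ≤ ‖φ n‖) ∧
      ∀ t, HasSum (fun n => α t n • x n) (z t)} := by
  set S := {z : T → F | ∃ x : ℕ → F, (∀ n, ‖x n‖ ≤ ‖φ n‖) ∧
      ∀ t, HasSum (fun n => α t n • x n) (z t)} with hSdef
  have hconv : Convex ℝ S := by
    rintro z ⟨x, hx, hz⟩ w ⟨v, hv, hw⟩ a b ha hb hab
    refine ⟨fun n => a • x n + b • v n, fun n => ?_, fun t => ?_⟩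
    · refine (norm_add_le _ _).trans ?_
      rw [norm_smul, norm_smul, Real.norm_of_nonneg ha, Real.norm_of_nonneg hb]
      calc _ ≤ a * ‖φ n‖ + b * ‖φ n‖ :=
            add_le_add (mul_le_mul_of_nonneg_left (hx n) ha) (mul_le_mul_of_nonneg_left (hv n) hb)
        _ = ‖φ n‖ := by rw [← add_mul, hab, one_mul]
    · convert ((hz t).const_smul a).add ((hw t).const_smul b) using 2 with n
      · rw [smul_add, smul_comm _ a, smul_comm _ b]
      · rfl
  by_contra hk
  obtain ⟨f, u, hfu, huk⟩ :=
    RCLike.geometric_hahn_banach_closed_point (𝕜 := ℂ) hconv.closure isClosed_closure hk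
  obtain ⟨y', hy'⟩ : ∃ y' : T → F →L[ℂ] ℂ,
    y' = fun t => f.comp (ContinuousLinearMap.single ℂ (fun _ => F) t) := ⟨_, rfl⟩
  have hf : ∀ z, f z = ∑ t, y' t (z t) := fun z => by
    simp only [hy', ContinuousLinearMap.comp_apply, ContinuousLinearMap.single_apply]
    rw [← map_sum, Finset.univ_sum_single]
  obtain ⟨ψ, hψ⟩ : ∃ ψ : ℕ → F →L[ℂ] ℂ, ψ = fun n => ∑ t, α t n • y' t := ⟨_, rfl⟩
  have hψx : ∀ n x, ψ n x = ∑ t, α t n * y' t x := fun n x => by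
    simp [hψ]
  have hfk : HasSum (fun n => φ n (ψ n)) (f k) := by
    have h1 : HasSum (fun n => ∑ t, α t n * φ n (y' t)) (∑ t, y' t (k t)) :=
      hasSum_sum fun t _ => (h t).2 (y' t)
    rw [hf]
    convert h1 using 2 with n
    simp [hψ]
  have hub : ∀ s : Finset ℕ, ∑ n ∈ s, ‖φ n‖ * ‖ψ n‖ ≤ u := fun s => by
    refine le_of_forall_pos_le_add fun ε hε => ?_
    have hη : 0 < ε / (s.card + 1) := by positivity
    choose x hx hxr using fun n => exists_almost_norming (ψ n) (norm_nonneg (φ n)) hη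
    have hz : (fun t => ∑ n ∈ s, α t n • x n) ∈ S := by
      refine ⟨fun n => if n ∈ s then x n else 0, fun n => ?_, fun t => ?_⟩
      · dsimp only
        split_ifs
        · exact hx n
        · rw [norm_zero]
          exact norm_nonneg (φ n)
      · have := hasSum_sum_of_ne_finset_zero (f := fun n => α t n • if n ∈ s then x n else 0)
          (s := s) (L := SummationFilter.unconditional ℕ) fun n hn => by simp [hn]
        convert this using 1
        exact Finset.sum_congr rfl fun n hn => by simp [hn]
    have h1 := hfu _ (subset_closure hz)
    have h2 : f (fun t => ∑ n ∈ s, α t n • x n) = ∑ n ∈ s, ψ n (x n) := by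
      rw [hf]
      simp only [map_sum, map_smul, smul_eq_mul, hψx]
      exact Finset.sum_comm
    rw [h2, map_sum] at h1
    have h3 := Finset.sum_le_sum fun n (_ : n ∈ s) => hxr n
    rw [Finset.sum_sub_distrib, Finset.sum_const, nsmul_eq_mul] at h3
    have h4 : s.card * (ε / (s.card + 1)) ≤ ε := by
      rw [mul_div_assoc', div_le_iff₀ (by positivity)]
      nlinarith
    have h5 : ∑ n ∈ s, (ψ n (x n)).re < u := h1
    linarith
  refine absurd huk (not_lt.2 ?_)
  refine hasSum_le_of_sum_le (Complex.hasSum_re hfk) fun s => (Finset.sum_le_sum fun n _ => ?_).trans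
    (hub s)
  exact (Complex.re_le_norm _).trans ((φ n).le_opNorm _)

lemma PBound.of_bidualRep_of_finite {T : Type*} [Fintype T] [CompleteSpace F] {p C δ : ℝ}
    (hp : 1 ≤ p) (hC : 0 < C) (hδ : 0 < δ) {φ : ℕ → (F →L[ℂ] ℂ) →L[ℂ] ℂ} (hφ : SeqBound p C φ)
    {α : T → ℕ → ℂ} {k : T → F} (h : ∀ t, BidualRep p φ (α t) (k t)) :
    PBound p (C + δ) k := by
  have hε : 0 < δ / (Fintype.card T + 1) := by positivity
  obtain ⟨z, ⟨x, hx, hz⟩, hkz⟩ := Metric.mem_closure_iff.1 (mem_closure_of_bidualRep h) _ hε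
  have h1 : PBound p C z := ⟨x, fun s => (Finset.sum_le_sum fun n _ =>
    Real.rpow_le_rpow (norm_nonneg _) (hx n) (by linarith)).trans (hφ s),
    fun t => ⟨α t, (h t).1, hz t⟩⟩
  have h2 : PBound p δ (k - z) := by
    have := PBound.of_finite (e := k - z) hp hε.le fun t =>
      (norm_le_pi_norm (k - z) t).trans (by rw [← dist_eq_norm]; exact hkz.le)
    rwa [mul_div_cancel₀ _ (by positivity)] at this
  refine PBound.hasSum (ι := Bool) (f := fun b => cond b z (k - z)) (c := fun b => cond b C δ) hp
    (by rintro (_ | _) <;> assumption) ?_ (by rintro (_ | _) <;> assumption) fun t => ?_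
  · convert hasSum_fintype (fun b => cond b C δ) using 1
    simp
  · convert hasSum_fintype (fun b => (cond b z (k - z)) t) using 1
    simp

lemma exists_finite_range_approx {T : Type*} {α : T → ℕ → ℂ} (hα : ∀ t n, ‖α t n‖ ≤ 1) (N : ℕ)
    {η : ℝ} (hη : 0 < η) :
    ∃ π : T → T, (Set.range π).Finite ∧ ∀ t, ∀ n < N, ‖α (π t) n - α t n‖ ≤ η := by
  obtain ⟨r, hr⟩ : ∃ r : T → Fin N → ℂ, r = fun t (n : Fin N) => α t n := ⟨_, rfl⟩
  have htb : TotallyBounded (Set.range r) := by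
    refine (isCompact_closedBall (0 : Fin N → ℂ) 1).totallyBounded.subset ?_
    rintro _ ⟨t, rfl⟩
    rw [mem_closedBall_zero_iff, pi_norm_le_iff_of_nonneg zero_le_one]
    exact fun n => by rw [hr]; exact hα t n
  obtain ⟨A, hA, hAf, hcov⟩ := Metric.finite_approx_of_totallyBounded htb η hη
  have hc : ∀ t, ∃ a ∈ A, r t ∈ ball a η := fun t => by
    simpa using hcov ⟨t, rfl⟩
  choose a haA ha using hc
  choose σ hσ using fun z : A => hA z.2
  have := hAf.to_subtype
  refine ⟨fun t => σ ⟨a t, haA t⟩, (Set.finite_range σ).subset ?_, fun t n hn => ?_⟩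
  · rintro _ ⟨t, rfl⟩
    exact ⟨_, rfl⟩
  · have h1 : ‖(a t - r t) ⟨n, hn⟩‖ ≤ η := (norm_le_pi_norm (a t - r t) ⟨n, hn⟩).trans
      (by rw [← dist_eq_norm, dist_comm]; exact (mem_ball.1 (ha t)).le)
    have h2 : r (σ ⟨a t, haA t⟩) = a t := hσ ⟨a t, haA t⟩
    rw [← h2, hr] at h1
    exact h1

/-- Weights that make `(φ_n)` small in `ℓ_p` while keeping bounded, after division, every
coefficient sequence that is small on a long initial segment. -/
lemma exists_rescaling {G : Type*} [NormedAddCommGroup G] [NormedSpace ℂ G] {p c : ℝ}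
    (hp : 1 ≤ p) (hc : 0 < c) {φ : ℕ → G} (hφ : Summable fun n => ‖φ n‖ ^ p) :
    ∃ N₀ : ℕ, ∀ N ≥ N₀, ∃ w : ℕ → ℝ, (∀ n, 0 < w n) ∧ SeqBound p c (fun n => (w n : ℂ) • φ n) ∧
      ∀ d : ℕ → ℂ, CoefBound p 2 d → (∀ n < N, ‖d n‖ ≤ 2 * (1 / (N + 1)) ^ 2) →
        CoefBound p 1 fun n => d n / w n := by
  have hp0 : 0 < p := by linarith
  have hcp : 0 < c ^ p := Real.rpow_pos_of_pos hc p
  set S := ∑' n, ‖φ n‖ ^ p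
  have hS : 0 ≤ S := tsum_nonneg fun n => by positivity
  obtain ⟨ε, hε, hεS⟩ : ∃ ε : ℝ, 0 < ε ∧ ε ^ p * S ≤ c ^ p / 2 := by
    refine ⟨(c ^ p / 2 / (S + 1)) ^ p⁻¹, by positivity, ?_⟩
    rw [Real.rpow_inv_rpow (by positivity) hp0.ne', div_mul_eq_mul_div,
      div_le_iff₀ (by positivity)]
    exact mul_le_mul_of_nonneg_left (by linarith) (by positivity)
  have htail : ∀ᶠ N in atTop, ∑' n, ‖φ (n + N)‖ ^ p < c ^ p / 2 / 3 ^ p :=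
    (tendsto_sum_nat_add fun n => ‖φ n‖ ^ p).eventually (gt_mem_nhds (by positivity))
  obtain ⟨N₁, hN₁⟩ := eventually_atTop.1 htail
  obtain ⟨N₂, hN₂⟩ := exists_nat_ge (6 / ε)
  refine ⟨max N₁ N₂, fun N hN => ?_⟩
  have hN1 := hN₁ N ((le_max_left _ _).trans hN)
  have hN2 : 6 / ε ≤ N + 1 := by
    have : (N₂ : ℝ) ≤ N := by exact_mod_cast (le_max_right _ _).trans hN
    linarith
  obtain ⟨w, hw⟩ : ∃ w : ℕ → ℝ, w = fun n => if n < N then ε else 3 := ⟨_, rfl⟩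
  have hw0 : ∀ n, 0 < w n := fun n => by rw [hw]; dsimp only; split_ifs <;> positivity
  refine ⟨w, hw0, fun s => ?_, fun d hd hdN s b hb => ?_⟩
  · have hnorm : ∀ n, ‖(w n : ℂ) • φ n‖ ^ p = w n ^ p * ‖φ n‖ ^ p := fun n => by
      rw [norm_smul, Complex.norm_real, Real.norm_of_nonneg (hw0 n).le,
        Real.mul_rpow (hw0 n).le (norm_nonneg _)]
    simp only [hnorm]
    have hsum : Summable fun n => w n ^ p * ‖φ n‖ ^ p := by
      rw [← summable_nat_add_iff N]
      refine (((summable_nat_add_iff N).2 hφ).mul_left (3 ^ p)).congr fun n => ?_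
      simp [hw]
    refine (hsum.sum_le_tsum s fun n _ =>
      mul_nonneg (Real.rpow_nonneg (hw0 n).le _) (by positivity)).trans ?_
    rw [← hsum.sum_add_tsum_nat_add N]
    have h1 : ∑ n ∈ Finset.range N, w n ^ p * ‖φ n‖ ^ p ≤ c ^ p / 2 := by
      calc _ = ε ^ p * ∑ n ∈ Finset.range N, ‖φ n‖ ^ p := by
            rw [Finset.mul_sum]
            exact Finset.sum_congr rfl fun n hn => by simp [hw, Finset.mem_range.1 hn]
        _ ≤ ε ^ p * S := mul_le_mul_of_nonneg_left
            (hφ.sum_le_tsum _ fun n _ => by positivity) (by positivity)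
        _ ≤ _ := hεS
    have h2 : ∑' n, w (n + N) ^ p * ‖φ (n + N)‖ ^ p ≤ c ^ p / 2 := by
      have : ∀ n, w (n + N) = 3 := fun n => by simp [hw]
      simp only [this]
      rw [tsum_mul_left, ← le_div_iff₀' (by positivity)]
      exact hN1.le
    linarith
  · set B := (∑ i ∈ s, b i ^ p) ^ (1 / p)
    have hnn : ∀ i, 0 ≤ b i ^ p := fun i => Real.rpow_nonneg (hb i) _
    have hbB : ∀ i ∈ s, b i ≤ B := fun i hi => by
      change b i ≤ (∑ i ∈ s, b i ^ p) ^ (1 / p)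
      rw [one_div, Real.le_rpow_inv_iff_of_pos (hb i) (Finset.sum_nonneg fun i _ => hnn i) hp0]
      exact Finset.single_le_sum (fun i _ => hnn i) hi
    have hB : 0 ≤ B := Real.rpow_nonneg (Finset.sum_nonneg fun i _ => hnn i) _
    have hterm : ∀ n, ‖d n / w n‖ * b n ≤
        (if n < N then 2 * (1 / (N + 1 : ℝ)) ^ 2 / ε * b n else 0) + ‖d n‖ * b n / 3 := fun n => by
      rw [norm_div, Complex.norm_real, Real.norm_of_nonneg (hw0 n).le]
      have h0 : 0 ≤ ‖d n‖ * b n / 3 := by have := hb n; positivity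
      by_cases hn : n < N
      · rw [if_pos hn]
        have h1 : ‖d n‖ / w n ≤ 2 * (1 / (N + 1 : ℝ)) ^ 2 / ε := by
          simp only [hw, if_pos hn]
          exact div_le_div_of_nonneg_right (hdN n hn) hε.le
        have := mul_le_mul_of_nonneg_right h1 (hb n)
        linarith
      · rw [if_neg hn]
        simp only [hw, if_neg hn]
        exact le_of_eq (by ring)
    refine (Finset.sum_le_sum fun n _ => hterm n).trans ?_
    rw [Finset.sum_add_distrib, ← Finset.sum_div, ← Finset.sum_filter]
    have h1 : ∑ n ∈ s with n < N, 2 * (1 / (N + 1 : ℝ)) ^ 2 / ε * b n ≤ B / 3 := by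
      calc _ ≤ ∑ n ∈ s with n < N, 2 * (1 / (N + 1 : ℝ)) ^ 2 / ε * B :=
            Finset.sum_le_sum fun n hn => mul_le_mul_of_nonneg_left
              (hbB n (Finset.mem_filter.1 hn).1) (by positivity)
        _ = (s.filter (· < N)).card * (2 * (1 / (N + 1 : ℝ)) ^ 2 / ε * B) := by simp
        _ ≤ (N + 1) * (2 * (1 / (N + 1 : ℝ)) ^ 2 / ε * B) := by
            refine mul_le_mul_of_nonneg_right ?_ (by positivity)
            have : (s.filter (· < N)).card ≤ N := by
              refine (Finset.card_le_card (t := Finset.range N) fun n hn => ?_).trans (by simp)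
              exact Finset.mem_range.2 (Finset.mem_filter.1 hn).2
            have : ((s.filter (· < N)).card : ℝ) ≤ N := by exact_mod_cast this
            linarith
        _ = 6 / ε / (N + 1) * (B / 3) := by field_simp; ring
        _ ≤ B / 3 := mul_le_of_le_one_left (by positivity) ((div_le_one (by positivity)).2 hN2)
    have h2 := hd s b hb
    linarith

lemma BidualRep.sub {p : ℝ} {φ : ℕ → (F →L[ℂ] ℂ) →L[ℂ] ℂ} {α β : ℕ → ℂ} {y z : F}
    (hy : BidualRep p φ α y) (hz : BidualRep p φ β z) {w : ℕ → ℝ} (hw : ∀ n, 0 < w n)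
    (h : CoefBound p 1 fun n => (α n - β n) / w n) :
    BidualRep p (fun n => (w n : ℂ) • φ n) (fun n => (α n - β n) / w n) (y - z) := by
  refine ⟨h, fun y' => ?_⟩
  rw [map_sub]
  have e : ∀ n, (α n - β n) / w n * ((w n : ℂ) • φ n) y' = α n * φ n y' - β n * φ n y' :=
    fun n => by
      have : (w n : ℂ) ≠ 0 := by exact_mod_cast (hw n).ne'
      rw [smul_apply, smul_eq_mul, ← mul_assoc, div_mul_cancel₀ _ this, sub_mul]
  simp only [e]
  exact (hy.2 y').sub (hz.2 y')

/-- A family in `F` that is `p`-compact in the bidual is `p`-compact in `F`, with the same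
measure. -/
lemma PBound.of_bidualRep {T : Type*} [CompleteSpace F] {p C δ : ℝ} (hp : 1 ≤ p) (hC : 0 < C)
    (hδ : 0 < δ) {φ : ℕ → (F →L[ℂ] ℂ) →L[ℂ] ℂ} (hφ : SeqBound p C φ) {k : T → F}
    (h : ∀ t, ∃ α, BidualRep p φ α (k t)) : PBound p (C + δ + δ) k := by
  choose α hα using h
  have hφs : Summable fun n => ‖φ n‖ ^ p :=
    SeqBound.summable (G := (F →L[ℂ] ℂ) →L[ℂ] ℂ) hφ
  obtain ⟨c, hc⟩ : ∃ c : ℕ → ℝ, c = fun i => δ / 2 / 2 ^ i / 2 := ⟨_, rfl⟩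
  have hc0 : ∀ i, 0 < c i := fun i => by rw [hc]; positivity
  have hcsum : HasSum (fun i => c i + c i) δ := by
    simpa only [hc, add_halves] using hasSum_geometric_two' δ
  obtain ⟨N, hNmono, hN⟩ := extraction_forall_of_eventually' fun i =>
    exists_rescaling (G := (F →L[ℂ] ℂ) →L[ℂ] ℂ) hp (hc0 i) hφs
  choose w hw0 hwb hw using hN
  choose π hπfin hπ using fun i => exists_finite_range_approx (fun t => (hα t).1.norm_le) (N i)
    (η := (1 / ((N i : ℝ) + 1)) ^ 2) (by positivity)
  have hrep : ∀ i t u, (∀ n < N i, ‖α t n - α u n‖ ≤ 2 * (1 / ((N i : ℝ) + 1)) ^ 2) →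
      BidualRep p (fun n => (w i n : ℂ) • φ n) (fun n => (α t n - α u n) / w i n) (k t - k u) :=
    fun i t u htu => (hα t).sub (hα u) (hw0 i) <| hw i _
      (by convert (hα t).1.sub (hα u).1 using 1; norm_num) htu
  have hstep : ∀ i t, ∀ n < N i,
      ‖α (π (i + 1) t) n - α (π i t) n‖ ≤ 2 * (1 / ((N i : ℝ) + 1)) ^ 2 := fun i t n hn => by
    have hlt := hNmono (Nat.lt_succ_self i)
    have h1 := hπ i t n hn
    have h2 := hπ (i + 1) t n (hn.trans hlt)
    have h3 : (1 / ((N (i + 1) : ℝ) + 1)) ^ 2 ≤ (1 / ((N i : ℝ) + 1)) ^ 2 := by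
      have : (N i : ℝ) ≤ N (i + 1) := by exact_mod_cast hlt.le
      gcongr
    calc _ ≤ ‖α (π (i + 1) t) n - α t n‖ + ‖α (π i t) n - α t n‖ := by
          rw [norm_sub_rev (α (π i t) n)]
          exact norm_sub_le_norm_sub_add_norm_sub _ _ _
      _ ≤ _ := by linarith
  have hnear : ∀ i t, ‖k (π i t) - k t‖ ≤ c i := fun i t =>
    (hrep i _ _ fun n hn => (hπ i t n hn).trans (le_mul_of_one_le_left (by positivity)
      one_le_two)).norm_le hp (hc0 i).le (hwb i)
  have hincr : ∀ i t, ‖k (π (i + 1) t) - k (π i t)‖ ≤ c i := fun i t =>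
    (hrep i _ _ (hstep i t)).norm_le hp (hc0 i).le (hwb i)
  have hP0 : PBound p (C + δ) (k ∘ π 0) := by
    have := (hπfin 0).fintype
    have h1 : PBound p (C + δ) fun u : Set.range (π 0) => k u :=
      PBound.of_bidualRep_of_finite hp hC hδ hφ fun u => hα u
    exact h1.comp fun t => ⟨π 0 t, t, rfl⟩
  have hP : ∀ i, PBound p (c i + c i) fun t => k (π (i + 1) t) - k (π i t) := fun i => by
    have hfin : (Set.range fun t => (π (i + 1) t, π i t)).Finite :=
      ((hπfin (i + 1)).prod (hπfin i)).subset (by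
        rintro _ ⟨t, rfl⟩
        exact ⟨⟨t, rfl⟩, ⟨t, rfl⟩⟩)
    have := hfin.fintype
    have h1 : PBound p (c i + c i)
        fun u : Set.range fun t => (π (i + 1) t, π i t) => k u.1.1 - k u.1.2 := by
      refine PBound.of_bidualRep_of_finite hp (hc0 i) (hc0 i) (hwb i)
        (α := fun u n => (α u.1.1 n - α u.1.2 n) / w i n) ?_
      rintro ⟨_, t, rfl⟩
      exact hrep i _ _ (hstep i t)
    exact h1.comp fun t => ⟨_, t, rfl⟩
  let f : ℕ → T → F
    | 0 => k ∘ π 0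
    | i + 1 => fun t => k (π (i + 1) t) - k (π i t)
  let C' : ℕ → ℝ
    | 0 => C + δ
    | i + 1 => c i + c i
  refine PBound.hasSum (f := f) (c := C') hp ?_ ?_ ?_ fun t => ?_
  · rintro (_ | i)
    · exact add_pos hC hδ
    · exact add_pos (hc0 i) (hc0 i)
  · exact hcsum.zero_add
  · rintro (_ | i)
    · exact hP0
    · exact hP i
  · have hsm : Summable fun i => ‖f i t‖ := by
      rw [← summable_nat_add_iff 1]
      exact Summable.of_nonneg_of_le (fun i => norm_nonneg _)
        (fun i => (hincr i t).trans (by linarith [hc0 i])) hcsum.summable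
    rw [hasSum_iff_tendsto_nat_of_summable_norm hsm, ← tendsto_add_atTop_iff_nat 1]
    have hpart : ∀ n, ∑ i ∈ Finset.range (n + 1), f i t = k (π n t) := fun n => by
      rw [Finset.sum_range_succ']
      change ∑ i ∈ Finset.range n, (k (π (i + 1) t) - k (π i t)) + k (π 0 t) = _
      rw [Finset.sum_range_sub fun i => k (π i t)]
      abel
    simp only [hpart]
    rw [tendsto_iff_norm_sub_tendsto_zero]
    refine squeeze_zero (fun _ => norm_nonneg _)
      (fun i => (hnear i t).trans (by linarith [hc0 i])) hcsum.summable.tendsto_atTop_zero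

lemma norm_polyEval_le {m : ℕ} (A : ContinuousMultilinearMap ℂ (fun _ : Fin m => E) F) {x : E}
    (hx : x ∈ closedBall (0 : E) 1) : ‖polyEval A x‖ ≤ ‖A‖ := by
  refine (A.le_opNorm _).trans (mul_le_of_le_one_right (norm_nonneg _) ?_)
  exact Finset.prod_le_one (fun _ _ => norm_nonneg _) fun _ _ => mem_closedBall_zero_iff.1 hx

lemma rpow_tsum_norm_rpow_nonneg {G : Type*} [NormedAddCommGroup G] (p : ℝ) (x : ℕ → G) :
    0 ≤ (∑' n, ‖x n‖ ^ p) ^ (1 / p) :=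
  Real.rpow_nonneg (tsum_nonneg fun n => Real.rpow_nonneg (norm_nonneg (x n)) p) _

lemma bddAbove_norm_apply_polyEval {m : ℕ}
    (A : ContinuousMultilinearMap ℂ (fun _ : Fin m => E) F) (y' : F →L[ℂ] ℂ) :
    BddAbove {r : ℝ | ∃ x ∈ closedBall (0 : E) 1, r = ‖y' (polyEval A x)‖} := by
  refine ⟨‖y'‖ * ‖A‖, ?_⟩
  rintro _ ⟨x, hx, rfl⟩
  exact (y'.le_opNorm _).trans
    (mul_le_mul_of_nonneg_left (norm_polyEval_le A hx) (norm_nonneg _))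

/-- A sequence whose `p`-convex hull contains the image of the unit ball witnesses quasi
`p`-nuclearity of the transpose. -/
lemma QuasiPNuclearWitness.of_subset_pCo {p : ℝ} (hp : 1 ≤ p) {m : ℕ}
    {A : ContinuousMultilinearMap ℂ (fun _ : Fin m => E) F} {x : ℕ → F}
    (hx : Summable fun n => ‖x n‖ ^ p) (hA : polyEval A '' closedBall 0 1 ⊆ pCo p x) :
    QuasiPNuclearWitness p A fun n => NormedSpace.inclusionInDoubleDualLi ℂ (x n) := by
  refine ⟨by simpa only [LinearIsometry.norm_map] using hx, fun y' => ?_⟩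
  change _ ≤ (∑' n, ‖y' (x n)‖ ^ p) ^ (1 / p)
  have hsum : Summable fun n => ‖y' (x n)‖ ^ p := by
    refine Summable.of_nonneg_of_le (fun n => by positivity) (fun n => ?_)
      (hx.mul_left (‖y'‖ ^ p))
    rw [← Real.mul_rpow (norm_nonneg _) (norm_nonneg _)]
    exact Real.rpow_le_rpow (norm_nonneg _) (y'.le_opNorm _) (by linarith)
  have hnn : 0 ≤ (∑' n, ‖y' (x n)‖ ^ p) ^ (1 / p) :=
    rpow_tsum_norm_rpow_nonneg p _
  refine Real.sSup_le ?_ hnn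
  rintro _ ⟨z, hz, rfl⟩
  obtain ⟨α, hα, hαz⟩ := hA ⟨z, hz, rfl⟩
  have h1 : HasSum (fun n => α n * y' (x n)) (y' (polyEval A z)) := by
    simpa using y'.hasSum hαz
  refine le_of_tendsto h1.norm (Eventually.of_forall fun s => ?_)
  refine (norm_sum_le _ _).trans ?_
  simp only [norm_mul]
  simpa using ((conjUnitBall_iff hp α).1 hα).sum_le hp zero_le_one hnn
    (SeqBound.of_summable hp hsum) s

/-- A sequence witnessing quasi `p`-nuclearity of the transpose yields, up to `ε`, a sequence
in `F` whose `p`-convex hull contains the image of the unit ball. -/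
lemma QuasiPNuclearWitness.exists_subset_pCo [CompleteSpace F] {p : ℝ} (hp : 1 ≤ p) {m : ℕ}
    {A : ContinuousMultilinearMap ℂ (fun _ : Fin m => E) F}
    {φ : ℕ → (F →L[ℂ] ℂ) →L[ℂ] ℂ} (h : QuasiPNuclearWitness p A φ) {ε : ℝ} (hε : 0 < ε) :
    ∃ x : ℕ → F, (Summable fun n => ‖x n‖ ^ p) ∧ polyEval A '' closedBall 0 1 ⊆ pCo p x ∧
      (∑' n, ‖x n‖ ^ p) ^ (1 / p) ≤ (∑' n, ‖φ n‖ ^ p) ^ (1 / p) + ε := by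
  obtain ⟨hφ, hA⟩ := h
  obtain ⟨C, hC⟩ : ∃ C : ℝ, C = (∑' n, ‖φ n‖ ^ p) ^ (1 / p) := ⟨_, rfl⟩
  have hC0 : 0 ≤ C := by
    rw [hC]
    exact rpow_tsum_norm_rpow_nonneg (G := (F →L[ℂ] ℂ) →L[ℂ] ℂ) p φ
  have hφb : SeqBound p C φ := by
    rw [hC]
    exact SeqBound.of_summable (G := (F →L[ℂ] ℂ) →L[ℂ] ℂ) hp hφ
  have hφb' : SeqBound p (C + ε / 3) φ :=
    SeqBound.mono (G := (F →L[ℂ] ℂ) →L[ℂ] ℂ) hp hC0 (by linarith) hφb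
  obtain ⟨x, hx, hxk⟩ := PBound.of_bidualRep hp (by linarith) (by linarith : 0 < ε / 3) hφb'
    (k := fun z : closedBall (0 : E) 1 => polyEval A z) fun z =>
      exists_bidualRep hp hφ fun y' =>
        (le_csSup (bddAbove_norm_apply_polyEval A y') ⟨z, z.2, rfl⟩).trans (hA y')
  refine ⟨x, hx.summable, ?_, ?_⟩
  · rintro _ ⟨z, hz, rfl⟩
    obtain ⟨α, hα, hαz⟩ := hxk ⟨z, hz⟩
    exact ⟨α, (conjUnitBall_iff hp α).2 hα, hαz⟩
  · rw [← hC]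
    exact (hx.tsum_le hp (by linarith)).trans (by linarith)

/-- **Corollary 2.5.** Let `E`, `F` be Banach spaces, `1 ≤ p < ∞`, and `P : E → F` a
continuous `m`-homogeneous polynomial.  Then `P` is `p`-compact if and only if its
transpose `P' : F' → P(^mE)`, `P'(y') = y' ∘ P`, is quasi `p`-nuclear; moreover in this
case `κ_p(P) = ν_p^Q(P')`. -/
theorem statement3 [CompleteSpace E] [CompleteSpace F] (p : ℝ) (hp : 1 ≤ p)
    (m : ℕ) (A : ContinuousMultilinearMap ℂ (fun _ : Fin m => E) F)
    (hsym : ∀ (v : Fin m → E) (σ : Equiv.Perm (Fin m)), A (v ∘ σ) = A v) :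
    (IsRelPCompact p (polyEval A '' closedBall 0 1) ↔
      ∃ φ : ℕ → (F →L[ℂ] ℂ) →L[ℂ] ℂ, QuasiPNuclearWitness p A φ) ∧
    (IsRelPCompact p (polyEval A '' closedBall 0 1) →
      mP p (polyEval A '' closedBall 0 1) =
        sInf {t : ℝ | ∃ φ : ℕ → (F →L[ℂ] ℂ) →L[ℂ] ℂ, QuasiPNuclearWitness p A φ ∧
          t = (∑' n, ‖φ n‖ ^ p) ^ (1 / p)}) := by
  refine ⟨⟨fun ⟨x, hx, hA⟩ => ⟨_, .of_subset_pCo hp hx hA⟩, fun ⟨φ, hφ⟩ => ?_⟩,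
    fun ⟨x, hx, hA⟩ => le_antisymm ?_ ?_⟩
  · obtain ⟨x, hx, hA, -⟩ := hφ.exists_subset_pCo hp one_pos
    exact ⟨x, hx, hA⟩
  · refine le_csInf ⟨_, _, .of_subset_pCo hp hx hA, rfl⟩ ?_
    rintro _ ⟨φ, hφ, rfl⟩
    refine le_of_forall_pos_le_add fun ε hε => ?_
    obtain ⟨z, hz, hAz, hle⟩ := hφ.exists_subset_pCo hp hε
    refine le_trans (csInf_le ?_ ⟨z, hz, hAz, rfl⟩) hle
    refine ⟨0, ?_⟩
    rintro _ ⟨u, -, -, rfl⟩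
    exact rpow_tsum_norm_rpow_nonneg p u
  · refine le_csInf ⟨_, x, hx, hA, rfl⟩ ?_
    rintro _ ⟨z, hz, hAz, rfl⟩
    refine csInf_le ?_ ⟨fun n => NormedSpace.inclusionInDoubleDualLi ℂ (z n),
      .of_subset_pCo hp hz hAz, by simp only [LinearIsometry.norm_map]⟩
    refine ⟨0, ?_⟩
    rintro _ ⟨φ, -, rfl⟩
    exact rpow_tsum_norm_rpow_nonneg (G := (F →L[ℂ] ℂ) →L[ℂ] ℂ) p φ

end
end

section
/- Let E and F be complex Banach spaces, 1 ≤ p < ∞, x₀ ∈ E, and f : E → F an entire function with Taylor series expansion ∑_{m=0}^∞ P_mf(x₀) at x₀. Then f is p-compact at x₀ if and only if every P_mf(x₀) is a p-compact m-homogeneous polynomial and limsup_m κ_p(P_mf(x₀))^{1/m} < ∞. -/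
open scoped ENNReal NNReal Classical
open Filter Metric

noncomputable section

variable {E F : Type*} [NormedAddCommGroup E] [NormedSpace ℂ E]
  [NormedAddCommGroup F] [NormedSpace ℂ F]

lemma conjUnitBall_one_iff {α : ℕ → ℂ} : ConjUnitBall 1 α ↔ ∀ n, ‖α n‖ ≤ 1 := by
  simp [ConjUnitBall]

lemma conjUnitBall_iff_of_one_lt {p : ℝ} (hp : 1 < p) {α : ℕ → ℂ} :
    ConjUnitBall p α ↔ ∀ s : Finset ℕ, ∑ n ∈ s, ‖α n‖ ^ (p / (p - 1)) ≤ 1 := by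
  have h0 : ∀ n, 0 ≤ ‖α n‖ ^ (p / (p - 1)) := fun n => by positivity
  rw [ConjUnitBall, if_neg hp.ne']
  constructor
  · rintro ⟨h1, h2⟩ s
    exact (h1.sum_le_tsum s fun n _ => h0 n).trans h2
  · intro h
    exact ⟨summable_of_sum_le h0 h, Real.tsum_le_of_sum_le h0 h⟩

lemma div_sub_one_pos {p : ℝ} (hp : 1 < p) : 0 < p / (p - 1) :=
  div_pos (by linarith) (by linarith)

lemma one_le_div_sub_one {p : ℝ} (hp : 1 < p) : 1 ≤ p / (p - 1) := by
  rw [one_le_div (by linarith)]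
  linarith

lemma ConjUnitBall.norm_le_one {p : ℝ} (hp : 1 ≤ p) {α : ℕ → ℂ} (h : ConjUnitBall p α) (n : ℕ) :
    ‖α n‖ ≤ 1 := by
  rcases hp.eq_or_lt with rfl | hp
  · exact conjUnitBall_one_iff.1 h n
  · have := (conjUnitBall_iff_of_one_lt hp).1 h {n}
    rw [Finset.sum_singleton] at this
    by_contra! h1
    exact this.not_gt (Real.one_lt_rpow h1 (div_sub_one_pos hp))

lemma ConjUnitBall.comp_injective {p : ℝ} (hp : 1 ≤ p) {α : ℕ → ℂ} (h : ConjUnitBall p α)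
    {φ : ℕ → ℕ} (hφ : Function.Injective φ) : ConjUnitBall p (α ∘ φ) := by
  rcases hp.eq_or_lt with rfl | hp
  · exact conjUnitBall_one_iff.2 fun n => conjUnitBall_one_iff.1 h _
  · rw [conjUnitBall_iff_of_one_lt hp] at h ⊢
    intro s
    simpa using h (s.map ⟨φ, hφ⟩)

lemma ConjUnitBall.smul_of_norm_le_one {p : ℝ} (hp : 1 ≤ p) {α : ℕ → ℂ} (h : ConjUnitBall p α)
    {c : ℂ} (hc : ‖c‖ ≤ 1) : ConjUnitBall p (c • α) := by
  have hle : ∀ n, ‖(c • α) n‖ ≤ ‖α n‖ := fun n => by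
    rw [Pi.smul_apply, norm_smul]
    exact mul_le_of_le_one_left (norm_nonneg _) hc
  rcases hp.eq_or_lt with rfl | hp
  · exact conjUnitBall_one_iff.2 fun n => (hle n).trans (conjUnitBall_one_iff.1 h n)
  · rw [conjUnitBall_iff_of_one_lt hp] at h ⊢
    intro s
    refine (Finset.sum_le_sum fun n _ => ?_).trans (h s)
    exact Real.rpow_le_rpow (norm_nonneg _) (hle n) (div_sub_one_pos hp).le

lemma convex_setOf_conjUnitBall {p : ℝ} (hp : 1 ≤ p) :
    Convex ℝ {α : ℕ → ℂ | ConjUnitBall p α} := by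
  intro α hα β hβ a b ha hb hab
  simp only [Set.mem_ofPred_eq] at hα hβ ⊢
  have hle : ∀ n, ‖(a • α + b • β) n‖ ≤ a * ‖α n‖ + b * ‖β n‖ := fun n => by
    refine (norm_add_le _ _).trans_eq ?_
    simp [abs_of_nonneg ha, abs_of_nonneg hb]
  rcases hp.eq_or_lt with rfl | hp
  · rw [conjUnitBall_one_iff] at hα hβ ⊢
    intro n
    nlinarith [hle n, hα n, hβ n]
  · rw [conjUnitBall_iff_of_one_lt hp] at hα hβ ⊢
    intro s
    calc ∑ n ∈ s, ‖(a • α + b • β) n‖ ^ (p / (p - 1))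
        ≤ ∑ n ∈ s, (a * ‖α n‖ ^ (p / (p - 1)) + b * ‖β n‖ ^ (p / (p - 1))) := by
          refine Finset.sum_le_sum fun n _ => ?_
          refine (Real.rpow_le_rpow (norm_nonneg _) (hle n) (div_sub_one_pos hp).le).trans ?_
          exact (convexOn_rpow (one_le_div_sub_one hp)).2 (norm_nonneg (α n))
            (norm_nonneg (β n)) ha hb hab
      _ = a * ∑ n ∈ s, ‖α n‖ ^ (p / (p - 1)) + b * ∑ n ∈ s, ‖β n‖ ^ (p / (p - 1)) := by
          rw [Finset.sum_add_distrib, Finset.mul_sum, Finset.mul_sum]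
      _ ≤ 1 := by nlinarith [hα s, hβ s]

lemma isClosed_setOf_conjUnitBall {p : ℝ} (hp : 1 ≤ p) :
    IsClosed {α : ℕ → ℂ | ConjUnitBall p α} := by
  rcases hp.eq_or_lt with rfl | hp
  · simp only [conjUnitBall_one_iff, Set.ofPred_forall]
    exact isClosed_iInter fun n => isClosed_le (by fun_prop) continuous_const
  · simp only [conjUnitBall_iff_of_one_lt hp, Set.ofPred_forall]
    refine isClosed_iInter fun s => isClosed_le ?_ continuous_const
    refine continuous_finsetSum _ fun n _ => ?_
    exact Continuous.rpow_const (by fun_prop) fun _ => Or.inr (div_sub_one_pos hp).le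

lemma isCompact_setOf_conjUnitBall {p : ℝ} (hp : 1 ≤ p) :
    IsCompact {α : ℕ → ℂ | ConjUnitBall p α} := by
  refine (isCompact_univ_pi fun _ : ℕ => isCompact_closedBall (0 : ℂ) 1).of_isClosed_subset
    (isClosed_setOf_conjUnitBall hp) fun α hα n _ => ?_
  simpa using ConjUnitBall.norm_le_one hp hα n

lemma ConjUnitBall.sum_norm_smul_le {p : ℝ} (hp : 1 ≤ p) {α : ℕ → ℂ} (h : ConjUnitBall p α)
    (x : ℕ → F) (s : Finset ℕ) :
    ∑ n ∈ s, ‖α n • x n‖ ≤ (∑ n ∈ s, ‖x n‖ ^ p) ^ (1 / p) := by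
  simp only [norm_smul]
  rcases hp.eq_or_lt with rfl | hp
  · simp only [Real.rpow_one, div_one]
    exact Finset.sum_le_sum fun n _ =>
      mul_le_of_le_one_left (norm_nonneg _) (conjUnitBall_one_iff.1 h n)
  · rw [conjUnitBall_iff_of_one_lt hp] at h
    have hpq : (p / (p - 1)).HolderConjugate p := (Real.HolderConjugate.conjExponent hp).symm
    refine (Real.inner_le_Lp_mul_Lq_of_nonneg s hpq (fun n _ => norm_nonneg (α n))
      (fun n _ => norm_nonneg (x n))).trans ?_
    refine mul_le_of_le_one_left (by positivity) ?_
    exact Real.rpow_le_one (by positivity) (h s) (one_div_nonneg.2 hpq.nonneg)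

lemma ConjUnitBall.sum_norm_smul_le_tsum {p : ℝ} (hp : 1 ≤ p) {α : ℕ → ℂ}
    (h : ConjUnitBall p α) {x : ℕ → F} (hx : Summable fun n => ‖x n‖ ^ p) (s : Finset ℕ) :
    ∑ n ∈ s, ‖α n • x n‖ ≤ (∑' n, ‖x n‖ ^ p) ^ (1 / p) := by
  refine (h.sum_norm_smul_le hp x s).trans ?_
  gcongr
  exact hx.sum_le_tsum s fun n _ => by positivity

lemma ConjUnitBall.summable_norm_smul {p : ℝ} (hp : 1 ≤ p) {α : ℕ → ℂ}
    (h : ConjUnitBall p α) {x : ℕ → F} (hx : Summable fun n => ‖x n‖ ^ p) :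
    Summable fun n => ‖α n • x n‖ :=
  summable_of_sum_le (fun _ => norm_nonneg _) (h.sum_norm_smul_le_tsum hp hx)

lemma ConjUnitBall.norm_tsum_smul_le {p : ℝ} (hp : 1 ≤ p) {α : ℕ → ℂ}
    (h : ConjUnitBall p α) {x : ℕ → F} (hx : Summable fun n => ‖x n‖ ^ p) :
    ‖∑' n, α n • x n‖ ≤ (∑' n, ‖x n‖ ^ p) ^ (1 / p) := by
  have hs := h.summable_norm_smul hp hx
  refine (norm_tsum_le_tsum_norm hs).trans ?_
  exact hs.tsum_le_of_sum_le (h.sum_norm_smul_le_tsum hp hx)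

lemma continuousOn_tsum_smul [CompleteSpace F] {p : ℝ} (hp : 1 ≤ p) {x : ℕ → F}
    (hx : Summable fun n => ‖x n‖ ^ p) :
    ContinuousOn (fun α : ℕ → ℂ => ∑' n, α n • x n) {α | ConjUnitBall p α} := by
  have hunif : TendstoUniformlyOn (fun N (α : ℕ → ℂ) => ∑ n ∈ Finset.range N, α n • x n)
      (fun α : ℕ → ℂ => ∑' n, α n • x n) atTop {α | ConjUnitBall p α} := by
    rw [Metric.tendstoUniformlyOn_iff]
    intro ε hε
    have ht : Tendsto (fun N => (∑' n, ‖x (n + N)‖ ^ p) ^ (1 / p)) atTop (nhds 0) := by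
      have := (tendsto_sum_nat_add fun n => ‖x n‖ ^ p).rpow_const (p := 1 / p)
        (Or.inr (by positivity))
      rwa [Real.zero_rpow (by positivity)] at this
    filter_upwards [ht.eventually_lt_const hε] with N hN α hα
    have hinj : Function.Injective fun n : ℕ => n + N := add_left_injective N
    have hsum : Summable fun n => α n • x n :=
      (ConjUnitBall.summable_norm_smul hp hα hx).of_norm
    rw [dist_eq_norm, ← hsum.sum_add_tsum_nat_add N, add_sub_cancel_left]
    exact ((ConjUnitBall.comp_injective hp hα hinj).norm_tsum_smul_le hp
      (hx.comp_injective hinj)).trans_lt hN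
  refine hunif.continuousOn (Eventually.of_forall fun N => Continuous.continuousOn ?_).frequently
  fun_prop

lemma pCo_eq_image [CompleteSpace F] {p : ℝ} (hp : 1 ≤ p) {x : ℕ → F}
    (hx : Summable fun n => ‖x n‖ ^ p) :
    pCo p x = (fun α : ℕ → ℂ => ∑' n, α n • x n) '' {α | ConjUnitBall p α} := by
  ext y
  constructor
  · rintro ⟨α, hα, hy⟩
    exact ⟨α, hα, hy.tsum_eq⟩
  · rintro ⟨α, hα, rfl⟩
    exact ⟨α, hα, (ConjUnitBall.summable_norm_smul hp hα hx).of_norm.hasSum⟩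

lemma isCompact_pCo [CompleteSpace F] {p : ℝ} (hp : 1 ≤ p) {x : ℕ → F}
    (hx : Summable fun n => ‖x n‖ ^ p) : IsCompact (pCo p x) := by
  rw [pCo_eq_image hp hx]
  exact (isCompact_setOf_conjUnitBall hp).image_of_continuousOn (continuousOn_tsum_smul hp hx)

lemma convex_pCo {p : ℝ} (hp : 1 ≤ p) (x : ℕ → F) : Convex ℝ (pCo p x) := by
  rintro y ⟨α, hα, hy⟩ z ⟨β, hβ, hz⟩ a b ha hb hab
  refine ⟨a • α + b • β, convex_setOf_conjUnitBall hp hα hβ ha hb hab, ?_⟩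
  convert (hy.const_smul a).add (hz.const_smul b) using 2 with n
  simp only [Pi.add_apply, Pi.smul_apply, add_smul, smul_assoc]

lemma smul_mem_pCo_of_norm_le_one {p : ℝ} (hp : 1 ≤ p) {x : ℕ → F} {y : F} (hy : y ∈ pCo p x)
    {c : ℂ} (hc : ‖c‖ ≤ 1) : c • y ∈ pCo p x := by
  obtain ⟨α, hα, hy⟩ := hy
  refine ⟨c • α, hα.smul_of_norm_le_one hp hc, ?_⟩
  simpa only [Pi.smul_apply, smul_assoc] using hy.const_smul c

lemma smul_mem_pCo_smul {p : ℝ} {x : ℕ → F} {y : F} (hy : y ∈ pCo p x) (c : ℂ) :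
    c • y ∈ pCo p (c • x) := by
  obtain ⟨α, hα, hy⟩ := hy
  refine ⟨α, hα, ?_⟩
  simpa only [Pi.smul_apply, smul_comm c] using hy.const_smul c

lemma norm_smul_rpow (c : ℂ) (p : ℝ) (x : ℕ → F) :
    (fun n => ‖(c • x) n‖ ^ p) = fun n => ‖c‖ ^ p * ‖x n‖ ^ p := by
  ext n
  rw [Pi.smul_apply, norm_smul, Real.mul_rpow (norm_nonneg _) (norm_nonneg _)]

lemma summable_mul_prod {a : ℕ → ℝ} {b : ℕ → ℕ → ℝ} (ha : ∀ m, 0 ≤ a m) (hb : ∀ m n, 0 ≤ b m n)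
    (h : ∀ m, Summable (b m)) (h' : Summable fun m => a m * ∑' n, b m n) :
    Summable fun w : ℕ × ℕ => a w.1 * b w.1 w.2 := by
  refine (summable_prod_of_nonneg fun w => mul_nonneg (ha _) (hb _ _)).2 ⟨fun m => ?_, ?_⟩
  · exact (h m).mul_left (a m)
  · simpa only [tsum_mul_left] using h'

/-- The weighted double sequence `2⁻⁽ᵐ⁺¹⁾ αₘₙ` lies in the unit ball when every row does. -/
lemma conjUnitBall_unpair {p : ℝ} (hp : 1 ≤ p) {α : ℕ → ℕ → ℂ} (h : ∀ m, ConjUnitBall p (α m)) :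
    ConjUnitBall p fun k =>
      ((2 : ℂ) ^ ((Nat.unpair k).1 + 1))⁻¹ * α (Nat.unpair k).1 (Nat.unpair k).2 := by
  rcases hp.eq_or_lt with rfl | hp
  · rw [conjUnitBall_one_iff]
    intro k
    rw [norm_mul, norm_inv, norm_pow, Complex.norm_ofNat]
    refine mul_le_one₀ (inv_le_one_of_one_le₀ (one_le_pow₀ one_le_two)) (norm_nonneg _)
      (conjUnitBall_one_iff.1 (h _) _)
  · set q := p / (p - 1) with hq
    have hq1 : 1 ≤ q := one_le_div_sub_one hp
    have h' : ∀ m, (Summable fun n => ‖α m n‖ ^ q) ∧ ∑' n, ‖α m n‖ ^ q ≤ 1 := fun m => by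
      simpa only [ConjUnitBall, if_neg hp.ne'] using h m
    set g : ℕ × ℕ → ℝ := fun z => (((2 : ℝ) ^ (z.1 + 1))⁻¹) ^ q * ‖α z.1 z.2‖ ^ q with hg
    have hg0 : 0 ≤ g := fun z => by positivity
    have hgeo : HasSum (fun m : ℕ => ((2 : ℝ) ^ (m + 1))⁻¹) 1 := by
      convert hasSum_geometric_two' 1 using 2 with m
      rw [pow_succ, mul_inv, div_eq_mul_inv, div_eq_mul_inv, one_mul, mul_comm]
    have hrow : ∀ m, ∑' n, g (m, n) ≤ ((2 : ℝ) ^ (m + 1))⁻¹ := fun m => by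
      simp only [hg, tsum_mul_left]
      refine (mul_le_of_le_one_right (by positivity) (h' m).2).trans ?_
      exact Real.rpow_le_self_of_le_one (by positivity)
        (inv_le_one_of_one_le₀ (one_le_pow₀ one_le_two)) hq1
    have hrow_summable : Summable fun m => ∑' n, g (m, n) :=
      hgeo.summable.of_nonneg_of_le (fun m => tsum_nonneg fun n => hg0 _) hrow
    have hsum : Summable g :=
      summable_mul_prod (a := fun m : ℕ => (((2 : ℝ) ^ (m + 1))⁻¹) ^ q)
        (b := fun m n => ‖α m n‖ ^ q) (fun m => by positivity) (fun m n => by positivity)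
        (fun m => (h' m).1) (by simpa only [hg, tsum_mul_left] using hrow_summable)
    have htsum : ∑' z, g z ≤ 1 := by
      rw [hsum.tsum_prod, ← hgeo.tsum_eq]
      exact hrow_summable.tsum_le_tsum hrow hgeo.summable
    have hnorm : (fun k => ‖((2 : ℂ) ^ ((Nat.unpair k).1 + 1))⁻¹ *
        α (Nat.unpair k).1 (Nat.unpair k).2‖ ^ q) = g ∘ Nat.pairEquiv.symm := by
      ext k
      simp only [hg, Function.comp_apply, Nat.pairEquiv_symm_apply, norm_mul, norm_inv, norm_pow,
        Complex.norm_ofNat]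
      rw [Real.mul_rpow (by positivity) (by positivity)]
    rw [ConjUnitBall, if_neg hp.ne', ← hq, hnorm]
    refine ⟨Nat.pairEquiv.symm.summable_iff.2 hsum, ?_⟩
    exact (Nat.pairEquiv.symm.tsum_eq g).trans_le htsum

lemma isRelPCompact_of_hasSum [CompleteSpace F] {p : ℝ} (hp : 1 ≤ p) {x : ℕ → ℕ → F}
    (hx : ∀ m, Summable fun n => ‖x m n‖ ^ p)
    (hx' : Summable fun m : ℕ => ((2 : ℝ) ^ (m + 1)) ^ p * ∑' n, ‖x m n‖ ^ p)
    {K : Set F} (hK : ∀ y ∈ K, ∃ u : ℕ → F, (∀ m, u m ∈ pCo p (x m)) ∧ HasSum u y) :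
    IsRelPCompact p K := by
  set z : ℕ → F := fun k => (2 : ℂ) ^ ((Nat.unpair k).1 + 1) • x (Nat.unpair k).1 (Nat.unpair k).2
    with hz
  have hsum : Summable fun k => ‖z k‖ ^ p := by
    have h1 : Summable fun w : ℕ × ℕ => ((2 : ℝ) ^ (w.1 + 1)) ^ p * ‖x w.1 w.2‖ ^ p :=
      summable_mul_prod (a := fun m : ℕ => ((2 : ℝ) ^ (m + 1)) ^ p)
        (b := fun m n => ‖x m n‖ ^ p) (fun m => by positivity) (fun m n => by positivity) hx hx'
    convert Nat.pairEquiv.symm.summable_iff.2 h1 using 2 with k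
    simp only [hz, Function.comp_apply, Nat.pairEquiv_symm_apply, norm_smul, norm_pow,
      Complex.norm_ofNat]
    rw [Real.mul_rpow (by positivity) (by positivity)]
  refine ⟨z, hsum, fun y hy => ?_⟩
  obtain ⟨u, hu, huy⟩ := hK y hy
  choose α hα hαu using hu
  have hβ := conjUnitBall_unpair hp hα
  refine ⟨_, hβ, ?_⟩
  have hfun : (fun k => (((2 : ℂ) ^ ((Nat.unpair k).1 + 1))⁻¹ *
      α (Nat.unpair k).1 (Nat.unpair k).2) • z k) =
      (fun w : ℕ × ℕ => α w.1 w.2 • x w.1 w.2) ∘ Nat.pairEquiv.symm := by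
    ext k
    simp only [hz, Function.comp_apply, Nat.pairEquiv_symm_apply, smul_smul]
    rw [mul_right_comm, inv_mul_cancel₀ (pow_ne_zero _ two_ne_zero), one_mul]
  have hs := (hβ.summable_norm_smul hp hsum).of_norm
  rw [hfun] at hs ⊢
  have hs' := Nat.pairEquiv.symm.summable_iff.1 hs
  have heq := (hs'.hasSum.prod_fiberwise hαu).unique huy
  exact Nat.pairEquiv.symm.hasSum_iff.2 (heq ▸ hs'.hasSum)

lemma taylorPoly_smul (f : E → F) (x₀ : E) (m : ℕ) (c : ℂ) (v : E) :
    taylorPoly f x₀ m (c • v) = c ^ m • taylorPoly f x₀ m v := by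
  have := (iteratedFDeriv ℂ m f x₀).map_smul_univ (fun _ => c) (fun _ => v)
  rw [taylorPoly, taylorPoly, this, smul_comm]
  simp

lemma HasFPowerSeriesAt.taylorPoly_eq [CompleteSpace F] {f : E → F} {x₀ : E}
    {P : FormalMultilinearSeries ℂ E F} (h : HasFPowerSeriesAt f P x₀) (m : ℕ) (v : E) :
    taylorPoly f x₀ m v = P m fun _ => v := by
  obtain ⟨r, hr⟩ := h
  rw [taylorPoly, ← hr.factorial_smul v m, ← Nat.cast_smul_eq_nsmul ℂ, smul_smul,
    inv_mul_cancel₀ (by exact_mod_cast m.factorial_ne_zero), one_smul]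

/-- Cauchy's integral formula for the homogeneous Taylor polynomials, as an interval average. -/
lemma smul_taylorPoly_eq_intervalAverage [CompleteSpace F] {f : E → F}
    (hf : ∀ x, AnalyticAt ℂ f x) (x₀ v : E) (m : ℕ) {R : ℝ} (hR : 0 < R) :
    (R : ℂ) ^ m • taylorPoly f x₀ m v =
      ⨍ θ in (0 : ℝ)..(2 * Real.pi), ((R : ℂ) / circleMap 0 R θ) ^ m •
        f (x₀ + circleMap 0 R θ • v) := by
  set g : ℂ → F := fun ζ => f (x₀ + ζ • v) with hg
  have hgd : Differentiable ℂ g := fun ζ =>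
    (hf _).differentiableAt.comp ζ (by fun_prop)
  obtain ⟨P, hP⟩ := hf x₀
  have hP' : HasFPowerSeriesAt g
      (P.compContinuousLinearMap (ContinuousLinearMap.toSpanSingleton ℂ v)) 0 := by
    obtain ⟨r, hr⟩ := hP
    have h1 : HasFPowerSeriesAt (fun y => f (y - -x₀)) P (x₀ + -x₀) := ⟨r, hr.comp_sub (-x₀)⟩
    have h2 : HasFPowerSeriesAt (fun y => f (y - -x₀)) P
        (ContinuousLinearMap.toSpanSingleton ℂ v 0) := by
      simpa using h1
    convert h2.compContinuousLinearMap using 1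
    ext ζ
    simp [hg, add_comm]
  lift R to ℝ≥0 using hR.le
  have hC : HasFPowerSeriesAt g (cauchyPowerSeries g 0 R) 0 :=
    ⟨⊤, hgd.hasFPowerSeriesOnBall 0 (by exact_mod_cast hR)⟩
  have key : P m (fun _ => (R : ℂ) • v) = cauchyPowerSeries g 0 R m fun _ => (R : ℂ) := by
    rw [← hP'.eq_formalMultilinearSeries hC,
      FormalMultilinearSeries.compContinuousLinearMap_apply]
    rfl
  rw [← taylorPoly_smul, hP.taylorPoly_eq]
  have hRC : ((R : ℝ) : ℂ) = (R : ℂ) := rfl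
  rw [hRC, key, cauchyPowerSeries_apply, interval_average_eq, circleIntegral, sub_zero,
    ← Complex.coe_smul, ← intervalIntegral.integral_smul, ← intervalIntegral.integral_smul]
  refine intervalIntegral.integral_congr fun θ _ => ?_
  have hne : circleMap 0 R θ ≠ 0 := circleMap_ne_center hR.ne'
  simp only [deriv_circleMap, sub_zero, smul_smul, hg]
  congr 1
  push_cast
  field_simp

lemma smul_taylorPoly_mem [CompleteSpace F] {f : E → F} (hf : ∀ x, AnalyticAt ℂ f x) {x₀ : E}
    {R : ℝ} (hR : 0 < R) {S : Set F} (hconv : Convex ℝ S) (hclosed : IsClosed S)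
    (hbal : ∀ c : ℂ, ‖c‖ ≤ 1 → ∀ y ∈ S, c • y ∈ S) (hfS : ∀ x ∈ closedBall x₀ R, f x ∈ S)
    (m : ℕ) {v : E} (hv : ‖v‖ ≤ 1) : (R : ℂ) ^ m • taylorPoly f x₀ m v ∈ S := by
  rw [smul_taylorPoly_eq_intervalAverage hf x₀ v m hR]
  have hne : ∀ θ, circleMap 0 R θ ≠ 0 := fun θ => circleMap_ne_center hR.ne'
  have hfc : Continuous f := continuous_iff_continuousAt.2 fun x => (hf x).continuousAt
  have hcm : Continuous fun θ : ℝ => circleMap 0 R θ := continuous_circleMap 0 R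
  have hcont : Continuous fun θ : ℝ => ((R : ℂ) / circleMap 0 R θ) ^ m •
      f (x₀ + circleMap 0 R θ • v) :=
    ((continuous_const.div hcm hne).pow m).smul
      (hfc.comp (continuous_const.add (hcm.smul continuous_const)))
  have hnorm : ∀ θ, ‖circleMap 0 R θ‖ = R := fun θ => by simp [abs_of_pos hR]
  refine hconv.set_average_mem hclosed ?_ ?_ (Eventually.of_forall fun θ => ?_) ?_
  · simp [Set.uIoc_of_le Real.two_pi_pos.le, Real.pi_pos]
  · simp [Set.uIoc_of_le Real.two_pi_pos.le, ENNReal.mul_eq_top]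
  · refine hbal _ ?_ _ (hfS _ ?_)
    · rw [norm_pow, norm_div, hnorm, Complex.norm_real, Real.norm_of_nonneg hR.le,
        div_self hR.ne', one_pow]
    · rw [mem_closedBall_iff_norm, add_sub_cancel_left, norm_smul, hnorm]
      exact mul_le_of_le_one_right hR.le hv
  · exact (intervalIntegrable_iff.1 (hcont.intervalIntegrable _ _))

lemma PCompactAt.exists_taylorPoly_bound [CompleteSpace F] {p : ℝ} (hp : 1 ≤ p) {f : E → F}
    (hf : ∀ x, AnalyticAt ℂ f x) {x₀ : E} (h : PCompactAt p f x₀) :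
    ∃ R : ℝ, 0 < R ∧ ∃ x : ℕ → F, (Summable fun n => ‖x n‖ ^ p) ∧
      ∀ m : ℕ, taylorPoly f x₀ m '' closedBall 0 1 ⊆ pCo p (((R : ℂ) ^ m)⁻¹ • x) := by
  obtain ⟨V, hV, x, hx, hVx⟩ := h
  obtain ⟨R, hR, hRV⟩ := Metric.nhds_basis_closedBall.mem_iff.1 hV
  refine ⟨R, hR, x, hx, fun m => ?_⟩
  rintro _ ⟨v, hv, rfl⟩
  have hmem := smul_taylorPoly_mem hf hR (convex_pCo hp x) (isCompact_pCo hp hx).isClosed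
    (fun c hc y hy => smul_mem_pCo_of_norm_le_one hp hy hc)
    (fun y hy => hVx ⟨y, hRV hy, rfl⟩) m (mem_closedBall_zero_iff.1 hv)
  have hne : (R : ℂ) ^ m ≠ 0 := pow_ne_zero _ (by exact_mod_cast hR.ne')
  simpa only [inv_smul_smul₀ hne] using smul_mem_pCo_smul hmem ((R : ℂ) ^ m)⁻¹

lemma summable_norm_smul_rpow {p : ℝ} {x : ℕ → F} (hx : Summable fun n => ‖x n‖ ^ p) (c : ℂ) :
    Summable fun n => ‖(c • x) n‖ ^ p := by
  rw [norm_smul_rpow]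
  exact hx.mul_left _

lemma mPE_le_of_subset_smul {p : ℝ} (hp : 1 ≤ p) {K : Set F} {x : ℕ → F}
    (hx : Summable fun n => ‖x n‖ ^ p) (c : ℂ) (hK : K ⊆ pCo p (c • x)) :
    mPE p K ≤ ENNReal.ofReal ‖c‖ * ENNReal.ofReal ((∑' n, ‖x n‖ ^ p) ^ (1 / p)) := by
  refine sInf_le ⟨c • x, summable_norm_smul_rpow hx c, hK, ?_⟩
  have h0 : 0 ≤ ∑' n, ‖x n‖ ^ p := tsum_nonneg fun n => by positivity
  rw [norm_smul_rpow, tsum_mul_left, Real.mul_rpow (by positivity) h0,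
    ← Real.rpow_mul (norm_nonneg _), mul_one_div_cancel (by positivity), Real.rpow_one,
    ENNReal.ofReal_mul (norm_nonneg _)]

lemma limsup_rpow_one_div_lt_top {a : ℕ → ℝ≥0∞} {R : ℝ} (hR : 0 < R) {M : ℝ≥0∞} (hM : M < ⊤)
    (ha : ∀ m, a m ≤ ENNReal.ofReal ‖((R : ℂ) ^ m)⁻¹‖ * M) :
    limsup (fun m : ℕ => a m ^ (1 / (m : ℝ))) atTop < ⊤ := by
  have hlt : ENNReal.ofReal R⁻¹ * max M 1 < ⊤ :=
    ENNReal.mul_lt_top ENNReal.ofReal_lt_top (max_lt hM ENNReal.one_lt_top)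
  refine lt_of_le_of_lt (limsup_le_of_le (h := ?_)) hlt
  filter_upwards [eventually_ge_atTop 1] with m hm
  have hm' : (1 : ℝ) ≤ m := by exact_mod_cast hm
  have hle : a m ≤ ENNReal.ofReal R⁻¹ ^ m * (max M 1) := by
    refine (ha m).trans ?_
    rw [norm_inv, norm_pow, Complex.norm_real, Real.norm_of_nonneg hR.le, ← inv_pow,
      ENNReal.ofReal_pow (by positivity)]
    gcongr
    exact le_max_left _ _
  refine (ENNReal.rpow_le_rpow hle (by positivity)).trans ?_
  rw [ENNReal.mul_rpow_of_nonneg _ _ (by positivity), ← ENNReal.rpow_natCast,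
    ← ENNReal.rpow_mul, mul_one_div_cancel (by positivity), ENNReal.rpow_one]
  gcongr
  refine (ENNReal.rpow_le_rpow_of_exponent_le (le_max_right _ _) ?_).trans_eq (ENNReal.rpow_one _)
  exact (div_le_one (by positivity)).2 hm'

lemma exists_seq_of_mPE_lt {p : ℝ} (hp : 1 ≤ p) {K : Set F} {C : ℝ}
    (h : mPE p K < ENNReal.ofReal C) :
    ∃ x : ℕ → F, (Summable fun n => ‖x n‖ ^ p) ∧ K ⊆ pCo p x ∧ ∑' n, ‖x n‖ ^ p ≤ C ^ p := by
  obtain ⟨_, ⟨x, hx, hK, rfl⟩, hlt⟩ := sInf_lt_iff.1 h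
  refine ⟨x, hx, hK, ?_⟩
  have h0 : 0 ≤ ∑' n, ‖x n‖ ^ p := tsum_nonneg fun n => by positivity
  have := (ENNReal.ofReal_lt_ofReal_iff_of_nonneg (by positivity)).1 hlt
  have h2 := Real.rpow_le_rpow (by positivity) this.le (zero_le_one.trans hp)
  rwa [← Real.rpow_mul h0, one_div_mul_cancel (by positivity), Real.rpow_one] at h2

lemma exists_eventually_lt_ofReal_pow {a : ℕ → ℝ≥0∞}
    (h : limsup (fun m : ℕ => a m ^ (1 / (m : ℝ))) atTop < ⊤) :
    ∃ C : ℝ, 0 < C ∧ ∀ᶠ m in atTop, a m < ENNReal.ofReal (C ^ m) := by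
  obtain ⟨C, hC, hCtop⟩ := exists_between h
  have hC0 : 0 < C := bot_le.trans_lt hC
  refine ⟨C.toReal, ENNReal.toReal_pos hC0.ne' hCtop.ne, ?_⟩
  filter_upwards [eventually_lt_of_limsup_lt hC, eventually_ge_atTop 1] with m hm hm1
  have hm0 : (0 : ℝ) < m := by exact_mod_cast hm1
  rw [ENNReal.ofReal_pow ENNReal.toReal_nonneg, ENNReal.ofReal_toReal hCtop.ne]
  have := ENNReal.rpow_lt_rpow hm hm0
  rwa [← ENNReal.rpow_mul, one_div_mul_cancel hm0.ne', ENNReal.rpow_one,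
    ENNReal.rpow_natCast] at this

lemma pCompactAt_of_eventually_mPE_lt [CompleteSpace F] {p : ℝ} (hp : 1 ≤ p) {f : E → F} {x₀ : E}
    (hf : AnalyticAt ℂ f x₀)
    (hP : ∀ m : ℕ, IsRelPCompact p (taylorPoly f x₀ m '' closedBall 0 1)) {C : ℝ} (hC : 0 < C)
    (hlt : ∀ᶠ m in atTop,
      mPE p (taylorPoly f x₀ m '' closedBall 0 1) < ENNReal.ofReal (C ^ m)) :
    PCompactAt p f x₀ := by
  have hseq : ∀ m, ∃ x : ℕ → F, (Summable fun n => ‖x n‖ ^ p) ∧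
      taylorPoly f x₀ m '' closedBall 0 1 ⊆ pCo p x ∧
      (mPE p (taylorPoly f x₀ m '' closedBall 0 1) < ENNReal.ofReal (C ^ m) →
        ∑' n, ‖x n‖ ^ p ≤ (C ^ m) ^ p) := fun m => by
    by_cases h : mPE p (taylorPoly f x₀ m '' closedBall 0 1) < ENNReal.ofReal (C ^ m)
    · obtain ⟨x, h1, h2, h3⟩ := exists_seq_of_mPE_lt hp h
      exact ⟨x, h1, h2, fun _ => h3⟩
    · obtain ⟨x, h1, h2⟩ := hP m
      exact ⟨x, h1, h2, fun h' => absurd h' h⟩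
  choose x hx hxP hxC using hseq
  obtain ⟨P, s, hs⟩ := hf
  obtain ⟨δ, hδ, hδs⟩ := ENNReal.lt_iff_exists_nnreal_btwn.1 hs.r_pos
  have hδ0 : (0 : ℝ) < δ := by exact_mod_cast hδ
  set r : ℝ := min δ (4 * C)⁻¹ with hr
  have hr0 : 0 < r := lt_min hδ0 (by positivity)
  have hrC : r * C ≤ 1 / 4 := by
    calc r * C ≤ (4 * C)⁻¹ * C := by gcongr; exact min_le_right _ _
      _ = 1 / 4 := by field_simp
  have hnorm : ∀ m, ‖(r : ℂ) ^ m‖ = r ^ m := fun m => by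
    rw [norm_pow, Complex.norm_real, Real.norm_of_nonneg hr0.le]
  refine ⟨ball x₀ r, ball_mem_nhds _ hr0,
    isRelPCompact_of_hasSum hp (x := fun m => (r : ℂ) ^ m • x m)
      (fun m => summable_norm_smul_rpow (hx m) _) ?_ ?_⟩
  · have hgeo : Summable fun m : ℕ => (2 : ℝ) ^ p * ((1 / 2 : ℝ) ^ p) ^ m :=
      (summable_geometric_of_lt_one (by positivity)
        (Real.rpow_lt_one (by norm_num) (by norm_num) (by positivity))).mul_left _
    refine hgeo.of_norm_bounded_eventually_nat ?_
    filter_upwards [hlt] with m hm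
    have h0 : 0 ≤ ∑' n, ‖x m n‖ ^ p := tsum_nonneg fun n => by positivity
    rw [norm_smul_rpow, tsum_mul_left, hnorm, Real.norm_of_nonneg (by positivity)]
    calc ((2 : ℝ) ^ (m + 1)) ^ p * ((r ^ m) ^ p * ∑' n, ‖x m n‖ ^ p)
        ≤ ((2 : ℝ) ^ (m + 1)) ^ p * ((r ^ m) ^ p * (C ^ m) ^ p) := by
          gcongr
          exact hxC m hm
      _ = (2 * (2 * (r * C)) ^ m) ^ p := by
          rw [← Real.mul_rpow (by positivity) (by positivity),
            ← Real.mul_rpow (by positivity) (by positivity)]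
          congr 1
          ring
      _ ≤ (2 * (1 / 2 : ℝ) ^ m) ^ p := by
          gcongr
          linarith
      _ = (2 : ℝ) ^ p * ((1 / 2 : ℝ) ^ p) ^ m := by
          rw [Real.mul_rpow (by positivity) (by positivity), ← Real.rpow_natCast_mul (by norm_num),
            ← Real.rpow_mul_natCast (by norm_num), mul_comm p]
  · rintro _ ⟨y, hy, rfl⟩
    have hy' : ‖y - x₀‖ < r := mem_ball_iff_norm.1 hy
    have hne : (r : ℂ) ≠ 0 := by exact_mod_cast hr0.ne'
    refine ⟨fun m => taylorPoly f x₀ m (y - x₀), fun m => ?_, ?_⟩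
    · have hsplit : y - x₀ = (r : ℂ) • ((r : ℂ)⁻¹ • (y - x₀)) := (smul_inv_smul₀ hne _).symm
      beta_reduce
      rw [hsplit, taylorPoly_smul]
      refine smul_mem_pCo_smul (hxP m ⟨_, ?_, rfl⟩) _
      rw [mem_closedBall_zero_iff, norm_smul, norm_inv, Complex.norm_real,
        Real.norm_of_nonneg hr0.le, inv_mul_le_iff₀ hr0, mul_one]
      exact hy'.le
    · have hmem : y - x₀ ∈ Metric.eball (0 : E) s := by
        refine Metric.eball_subset_eball hδs.le ?_
        rw [Metric.eball_coe, mem_ball_zero_iff]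
        exact hy'.trans_le (min_le_left _ _)
      simpa [taylorPoly] using hs.hasSum_iteratedFDeriv hmem

/-- **Proposition 3.4.** Let `E`, `F` be complex Banach spaces, `1 ≤ p < ∞`, `x₀ ∈ E`, and
`f : E → F` entire with Taylor series expansion `∑ P_mf(x₀)` at `x₀`.  Then `f` is
`p`-compact at `x₀` if and only if every `P_mf(x₀)` is a `p`-compact homogeneous polynomial
and `limsup κ_p(P_mf(x₀))^{1/m} < ∞`. -/
theorem statement6 [CompleteSpace E] [CompleteSpace F] (p : ℝ) (hp : 1 ≤ p)
    (f : E → F) (hf : ∀ x, AnalyticAt ℂ f x) (x₀ : E) :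
    PCompactAt p f x₀ ↔
      (∀ m : ℕ, IsRelPCompact p (taylorPoly f x₀ m '' closedBall 0 1)) ∧
      Filter.limsup
        (fun m : ℕ => (mPE p (taylorPoly f x₀ m '' closedBall 0 1)) ^ (1 / (m : ℝ)))
        Filter.atTop < ⊤ := by
  constructor
  · intro h
    obtain ⟨R, hR, x, hx, hsub⟩ := h.exists_taylorPoly_bound hp hf
    exact ⟨fun m => ⟨_, summable_norm_smul_rpow hx _, hsub m⟩,
      limsup_rpow_one_div_lt_top hR ENNReal.ofReal_lt_top
        fun m => mPE_le_of_subset_smul hp hx _ (hsub m)⟩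
  · rintro ⟨hP, hlim⟩
    obtain ⟨C, hC, hlt⟩ := exists_eventually_lt_ofReal_pow hlim
    exact pCompactAt_of_eventually_mPE_lt hp (hf x₀) hP hC hlt

end
end

section
/- For every 1 ≤ p < ∞ there exists an entire function f : ℓ₁ → ℓ_p (complex Banach spaces) such that for every y ∈ ℓ₁ and every m ∈ ℕ the m-homogeneous polynomial P_mf(y) in the Taylor series expansion of f at y is 1-compact (hence r-compact for all 1 ≤ r < ∞), but f is not p-compact at any point y ∈ ℓ₁. -/
open scoped ENNReal NNReal Classical
open Filter Metric

noncomputable section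

variable {E F : Type*} [NormedAddCommGroup E] [NormedSpace ℂ E]
  [NormedAddCommGroup F] [NormedSpace ℂ F]

instance (p : ℝ) [hp : Fact (1 ≤ p)] : Fact (1 ≤ ENNReal.ofReal p) :=
  ⟨by rw [← ENNReal.ofReal_one]; exact ENNReal.ofReal_le_ofReal hp.out⟩

/-! ### Summable sequences in `ℓ_P` -/

theorem memℓp_of_summable_norm {P : ℝ≥0∞} [hP : Fact (1 ≤ P)] {g : ℕ → ℂ}
    (hg : Summable fun n => ‖g n‖) : Memℓp g P := by
  refine Memℓp.of_exponent_ge (q := 1) (memℓp_gen ?_) hP.out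
  simpa using hg

theorem lp_norm_le_tsum {P : ℝ≥0∞} [hP : Fact (1 ≤ P)] (hPt : P ≠ ∞)
    (g : lp (fun _ : ℕ => ℂ) P) (hg : Summable fun n => ‖g n‖) : ‖g‖ ≤ ∑' n, ‖g n‖ := by
  have h := lp.hasSum_single hPt g
  have hn : ∀ n, ‖(lp.single P n (g n) : lp (fun _ : ℕ => ℂ) P)‖ = ‖g n‖ := fun n =>
    lp.norm_single (E := fun _ : ℕ => ℂ) (zero_lt_one.trans_le hP.out) n (g n)
  have hg' : Summable fun n => ‖(lp.single P n (g n) : lp (fun _ : ℕ => ℂ) P)‖ :=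
    hg.congr fun n => (hn n).symm
  calc ‖g‖ = ‖∑' n, (lp.single P n (g n) : lp (fun _ : ℕ => ℂ) P)‖ := by rw [h.tsum_eq]
    _ ≤ ∑' n, ‖(lp.single P n (g n) : lp (fun _ : ℕ => ℂ) P)‖ := norm_tsum_le_tsum_norm hg'
    _ = ∑' n, ‖g n‖ := tsum_congr hn

theorem summable_norm_lp_one (y : lp (fun _ : ℕ => ℂ) 1) : Summable fun n => ‖y n‖ := by
  simpa using (lp.memℓp y).summable (by simp)

theorem tsum_norm_lp_one (y : lp (fun _ : ℕ => ℂ) 1) : ∑' n, ‖y n‖ = ‖y‖ := by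
  simpa using (lp.norm_eq_tsum_rpow (by simp) y).symm

theorem eventually_norm_lp_one_le (y : lp (fun _ : ℕ => ℂ) 1) {c : ℝ} (hc : 0 < c) :
    ∀ᶠ n in atTop, ‖y n‖ ≤ c :=
  (summable_norm_lp_one y).tendsto_atTop_zero.eventually (ge_mem_nhds hc)

/-! ### Relatively `p`-compact sets -/

theorem isRelPCompact_of_norm_apply_le {P : ℝ≥0∞} [hP : Fact (1 ≤ P)] (hPt : P ≠ ∞)
    {K : Set (lp (fun _ : ℕ => ℂ) P)} {c : ℕ → ℝ} (hc : Summable c)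
    (hK : ∀ z ∈ K, ∀ n, ‖z n‖ ≤ c n) : IsRelPCompact 1 K := by
  rcases K.eq_empty_or_nonempty with rfl | ⟨w, hw⟩
  · exact ⟨0, by simp, by simp⟩
  have hc0 : ∀ n, 0 ≤ c n := fun n => (norm_nonneg _).trans (hK w hw n)
  refine ⟨fun n => lp.single P n (c n : ℂ), ?_, fun z hz => ?_⟩
  · have hn : ∀ n, ‖(lp.single P n (c n : ℂ) : lp (fun _ : ℕ => ℂ) P)‖ = c n := fun n => by
      rw [lp.norm_single (E := fun _ : ℕ => ℂ) (zero_lt_one.trans_le hP.out) n]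
      simp [abs_of_nonneg (hc0 n)]
    simpa [hn] using hc
  · refine ⟨fun n => z n / c n, ?_, ?_⟩
    · simp only [ConjUnitBall, if_true, norm_div, Complex.norm_real, Real.norm_eq_abs]
      intro n
      rw [abs_of_nonneg (hc0 n)]
      exact div_le_one_of_le₀ (hK z hz n) (hc0 n)
    · convert lp.hasSum_single hPt z using 2 with n
      rw [← lp.single_smul]
      congr 1
      rcases (hc0 n).eq_or_lt with h | h
      · have : z n = 0 := by simpa [← h] using hK z hz n
        simp [this]
      · have : (c n : ℂ) ≠ 0 := by exact_mod_cast h.ne'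
        simp [this]

theorem IsRelPCompact.of_one {K : Set F} (hK : IsRelPCompact 1 K) {r : ℝ} (hr : 1 ≤ r) :
    IsRelPCompact r K := by
  rcases hr.eq_or_lt with rfl | hr1
  · exact hK
  obtain ⟨x, hx, hKx⟩ := hK
  simp only [Real.rpow_one] at hx
  have hr0 : 0 < r := by linarith
  have hs0 : 0 < r / (r - 1) := div_pos hr0 (by linarith)
  set T := ∑' n, ‖x n‖ + 1 with hT
  have hT0 : 0 < T := by linarith [(tsum_nonneg fun n => norm_nonneg (x n) : 0 ≤ ∑' n, ‖x n‖)]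
  -- The weights `b n` form an element of the unit ball of `ℓ_s`.
  set b : ℕ → ℝ := fun n => (‖x n‖ / T) ^ ((r - 1) / r) with hb
  have hb0 : ∀ n, 0 ≤ b n := fun n => by positivity
  have hbs : ∀ n, b n ^ (r / (r - 1)) = ‖x n‖ / T := fun n => by
    rw [hb, ← Real.rpow_mul (by positivity), div_mul_div_cancel₀ hr0.ne',
      div_self (by linarith), Real.rpow_one]
  have hne : ∀ n, x n ≠ 0 → b n ≠ 0 := fun n h => by
    have := norm_pos_iff.2 h
    positivity
  refine ⟨fun n => ((b n)⁻¹ : ℂ) • x n, ?_, fun z hz => ?_⟩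
  · refine (hx.mul_left (T ^ (r - 1))).congr fun n => ?_
    by_cases h : x n = 0
    · simp [h, hr0.ne']
    have h0 := norm_pos_iff.2 h
    rw [norm_smul, norm_inv, Complex.norm_real, Real.norm_of_nonneg (hb0 n),
      Real.mul_rpow (by positivity) (by positivity), Real.inv_rpow (hb0 n), hb,
      ← Real.rpow_mul (by positivity), div_mul_cancel₀ _ hr0.ne', Real.div_rpow h0.le hT0.le,
      inv_div, div_mul_eq_mul_div, mul_div_assoc, ← Real.rpow_sub h0]
    simp
  · obtain ⟨α, hα, hs⟩ := hKx hz
    simp only [ConjUnitBall, if_true] at hα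
    have hle : ∀ n, ‖α n * b n‖ ^ (r / (r - 1)) ≤ ‖x n‖ / T := fun n => by
      rw [← hbs, norm_mul, Complex.norm_real, Real.norm_of_nonneg (hb0 n)]
      have := mul_le_mul_of_nonneg_right (hα n) (hb0 n)
      rw [one_mul] at this
      gcongr
    have hsum : Summable fun n => ‖α n * b n‖ ^ (r / (r - 1)) :=
      Summable.of_nonneg_of_le (fun n => by positivity) hle (hx.div_const T)
    refine ⟨fun n => α n * b n, ?_, ?_⟩
    · rw [ConjUnitBall, if_neg hr1.ne']
      refine ⟨hsum, (hsum.tsum_le_tsum hle (hx.div_const T)).trans ?_⟩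
      rw [tsum_div_const, div_le_one hT0]
      linarith
    · convert hs using 2 with n
      by_cases h : x n = 0
      · simp [h]
      · have : (b n : ℂ) ≠ 0 := by exact_mod_cast hne n h
        rw [smul_smul, mul_assoc, mul_inv_cancel₀ this, mul_one]

/-- Hölder's inequality for the coefficients in a `p`-convex hull. -/
theorem ConjUnitBall.norm_rpow_le_tsum {p : ℝ} (hp : 1 ≤ p) {α a : ℕ → ℂ} {z : ℂ}
    (hα : ConjUnitBall p α) (ha : Summable fun n => ‖a n‖ ^ p)
    (hz : HasSum (fun n => α n * a n) z) : ‖z‖ ^ p ≤ ∑' n, ‖a n‖ ^ p := by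
  rcases hp.eq_or_lt with rfl | hp1
  · simp only [ConjUnitBall, if_true, Real.rpow_one] at *
    have hle : ∀ n, ‖α n * a n‖ ≤ ‖a n‖ := fun n => by
      simpa using mul_le_mul_of_nonneg_right (hα n) (norm_nonneg (a n))
    have hs : Summable fun n => ‖α n * a n‖ :=
      Summable.of_nonneg_of_le (fun n => norm_nonneg _) hle ha
    rw [← hz.tsum_eq]
    exact (norm_tsum_le_tsum_norm hs).trans (hs.tsum_le_tsum hle ha)
  · rw [ConjUnitBall, if_neg hp1.ne'] at hα
    have hpq : p.HolderConjugate (p / (p - 1)) := Real.HolderConjugate.conjExponent hp1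
    obtain ⟨hs, hle⟩ := Real.summable_and_inner_le_Lp_mul_Lq_tsum_of_nonneg hpq
      (fun n => norm_nonneg (a n)) (fun n => norm_nonneg (α n)) ha hα.1
    have hs' : Summable fun n => ‖α n * a n‖ := by simpa [mul_comm] using hs
    have h1 : ‖z‖ ≤ (∑' n, ‖a n‖ ^ p) ^ (1 / p) := by
      rw [← hz.tsum_eq]
      refine (norm_tsum_le_tsum_norm hs').trans ?_
      simp only [norm_mul, mul_comm ‖α _‖]
      refine hle.trans (mul_le_of_le_one_right (by positivity) ?_)
      exact Real.rpow_le_one (tsum_nonneg fun n => by positivity) hα.2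
        (one_div_nonneg.2 hpq.symm.nonneg)
    calc ‖z‖ ^ p ≤ ((∑' n, ‖a n‖ ^ p) ^ (1 / p)) ^ p := by gcongr
      _ = _ := by
        rw [← Real.rpow_mul (tsum_nonneg fun n => by positivity),
          one_div_mul_cancel (by linarith), Real.rpow_one]

/-- The coordinatewise suprema of a relatively `p`-compact subset of `ℓ_p` are dominated by a
`p`-summable sequence. -/
theorem IsRelPCompact.exists_summable {p : ℝ} [hp : Fact (1 ≤ p)]
    {K : Set (lp (fun _ : ℕ => ℂ) (ENNReal.ofReal p))} (hK : IsRelPCompact p K) :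
    ∃ S : ℕ → ℝ, Summable S ∧ ∀ z ∈ K, ∀ j, ‖z j‖ ^ p ≤ S j := by
  obtain ⟨x, hx, hKx⟩ := hK
  have hp0 : 0 < p := by linarith [hp.out]
  have hP : (ENNReal.ofReal p).toReal = p := ENNReal.toReal_ofReal hp0.le
  have hrow : ∀ n, HasSum (fun j => ‖x n j‖ ^ p) (‖x n‖ ^ p) := fun n => by
    simpa [hP] using lp.hasSum_norm (by rwa [hP]) (x n)
  have hprod : Summable fun q : ℕ × ℕ => ‖x q.1 q.2‖ ^ p := by
    rw [summable_prod_of_nonneg fun q => by positivity]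
    exact ⟨fun n => (hrow n).summable, hx.congr fun n => (hrow n).tsum_eq.symm⟩
  have hprod' : Summable fun q : ℕ × ℕ => ‖x q.2 q.1‖ ^ p := hprod.prod_symm
  refine ⟨fun j => ∑' n, ‖x n j‖ ^ p, hprod'.prod, fun z hz j => ?_⟩
  obtain ⟨α, hα, hs⟩ := hKx hz
  refine hα.norm_rpow_le_tsum hp.out (hprod'.prod_factor j) ?_
  exact hs.mapL (lp.evalCLM ℂ (fun _ : ℕ => ℂ) (ENNReal.ofReal p) j)

/-! ### A slowly growing sequence of degrees -/

/-- A sequence tending to infinity more slowly than the logarithm. -/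
def slowDegree (j : ℕ) : ℕ := Nat.sqrt (Nat.log 2 j)

theorem tendsto_slowDegree : Tendsto slowDegree atTop atTop := by
  refine tendsto_atTop.2 fun b => ?_
  filter_upwards [eventually_ge_atTop (2 ^ (b * b))] with j hj
  exact Nat.le_sqrt.2 ((Nat.le_log_iff_pow_le one_lt_two
    ((Nat.two_pow_pos _).trans_le hj).ne').2 hj)

theorem not_summable_pow_slowDegree {δ : ℝ} (hδ : 0 < δ) :
    ¬ Summable fun j => δ ^ slowDegree j := by
  intro hs
  obtain ⟨s, hs2⟩ := exists_pow_lt_of_lt_one hδ (by norm_num : (1 / 2 : ℝ) < 1)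
  refine Real.not_summable_natCast_inv (Summable.of_norm_bounded_eventually_nat hs ?_)
  filter_upwards [tendsto_slowDegree.eventually_ge_atTop s, eventually_ge_atTop 1] with j hj hj1
  have h1 : 2 ^ (s * slowDegree j) ≤ j := by
    refine (Nat.pow_le_pow_right two_pos ?_).trans (Nat.pow_log_le_self 2 (by omega))
    exact (Nat.mul_le_mul_right _ hj).trans (Nat.sqrt_le _)
  have h2 : (2 : ℝ) ^ (s * slowDegree j) ≤ j := by exact_mod_cast h1
  rw [norm_inv, Real.norm_natCast]
  calc (j : ℝ)⁻¹ ≤ (2 ^ (s * slowDegree j))⁻¹ := by gcongr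
    _ = ((1 / 2) ^ s) ^ slowDegree j := by rw [← pow_mul, one_div, inv_pow]
    _ ≤ δ ^ slowDegree j := by gcongr

/-! ### The diagonal map and its Taylor series -/

/-- The coefficients of the `k`-th Taylor polynomial at `y` of the map
`x ↦ (x j ^ slowDegree j)`, coordinate by coordinate. -/
def diagCoeff (y : ℕ → ℂ) (k j : ℕ) : ℂ := (slowDegree j).choose k * y j ^ (slowDegree j - k)

theorem summable_norm_diagCoeff (y : lp (fun _ : ℕ => ℂ) 1) (k : ℕ) :
    Summable fun j => ‖diagCoeff y k j‖ := by
  refine Summable.of_norm_bounded_eventually_nat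
    ((summable_norm_lp_one y).mul_left (2 ^ k * 2)) ?_
  filter_upwards [tendsto_slowDegree.eventually_ge_atTop (k + 1),
    eventually_norm_lp_one_le y (by norm_num : (0 : ℝ) < 1 / 2)] with j hj hy
  obtain ⟨d, hd⟩ := Nat.exists_eq_add_of_le hj
  have hc : ((slowDegree j).choose k : ℝ) ≤ 2 ^ slowDegree j := by
    exact_mod_cast Nat.choose_le_two_pow _ _
  rw [norm_norm, diagCoeff, norm_mul, norm_pow, Complex.norm_natCast]
  calc ((slowDegree j).choose k : ℝ) * ‖y j‖ ^ (slowDegree j - k)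
      ≤ 2 ^ slowDegree j * ‖y j‖ ^ (slowDegree j - k) := by gcongr
    _ = 2 ^ k * 2 * ‖y j‖ * (2 * ‖y j‖) ^ d := by
      rw [hd, show k + 1 + d - k = d + 1 by omega]
      ring
    _ ≤ 2 ^ k * 2 * ‖y j‖ := by
      refine mul_le_of_le_one_right (by positivity) (pow_le_one₀ (by positivity) ?_)
      linarith

theorem exists_norm_diagCoeff_mul_le (y : lp (fun _ : ℕ => ℂ) 1) :
    ∃ C : ℝ, ∀ k j, ‖diagCoeff y k j‖ * (1 / 4) ^ k ≤ C := by
  have hb : BddAbove (Set.range fun j => (‖y j‖ + 1 / 4) ^ slowDegree j) := by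
    refine IsBoundedUnder.bddAbove_range ⟨1, ?_⟩
    rw [eventually_map]
    filter_upwards [eventually_norm_lp_one_le y (by norm_num : (0 : ℝ) < 1 / 2)] with j hy
    exact pow_le_one₀ (by positivity) (by linarith)
  obtain ⟨C, hC⟩ := hb
  refine ⟨C, fun k j => le_trans ?_ (hC ⟨j, rfl⟩)⟩
  rw [diagCoeff, norm_mul, norm_pow, Complex.norm_natCast]
  rcases le_or_gt k (slowDegree j) with hk | hk
  · simp only [add_comm ‖y j‖]
    rw [add_pow]
    refine le_trans (le_of_eq ?_) (Finset.single_le_sum (f := fun i =>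
      (1 / 4 : ℝ) ^ i * ‖y j‖ ^ (slowDegree j - i) * (slowDegree j).choose i)
      (fun i _ => by positivity) (Finset.mem_range.2 (Nat.lt_succ_of_le hk)))
    ring
  · rw [Nat.choose_eq_zero_of_lt hk]
    simp only [Nat.cast_zero, zero_mul]
    positivity

theorem norm_diagCoeff_mul_prod_le (y : lp (fun _ : ℕ => ℂ) 1) (k : ℕ)
    (v : Fin k → lp (fun _ : ℕ => ℂ) 1) (j : ℕ) :
    ‖diagCoeff y k j * ∏ i, v i j‖ ≤ ‖diagCoeff y k j‖ * ∏ i, ‖v i‖ := by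
  rw [norm_mul, norm_prod]
  gcongr with i
  exact lp.norm_apply_le_norm one_ne_zero _ _

theorem summable_norm_diagCoeff_mul_prod (y : lp (fun _ : ℕ => ℂ) 1) (k : ℕ)
    (v : Fin k → lp (fun _ : ℕ => ℂ) 1) :
    Summable fun j => ‖diagCoeff y k j * ∏ i, v i j‖ :=
  Summable.of_nonneg_of_le (fun _ => norm_nonneg _) (norm_diagCoeff_mul_prod_le y k v)
    ((summable_norm_diagCoeff y k).mul_right _)

section Diagonal

variable (P : ℝ≥0∞) [hP : Fact (1 ≤ P)]

/-- The `k`-th term of the Taylor series of the diagonal map at `y`, as a multilinear map. -/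
def diagTerm (y : lp (fun _ : ℕ => ℂ) 1) (k : ℕ) :
    MultilinearMap ℂ (fun _ : Fin k => lp (fun _ : ℕ => ℂ) 1) (lp (fun _ : ℕ => ℂ) P) where
  toFun v := ⟨fun j => diagCoeff y k j * ∏ i, v i j,
    memℓp_of_summable_norm (summable_norm_diagCoeff_mul_prod y k v)⟩
  map_update_add' v i a b := by
    ext j
    have h := ((MultilinearMap.mkPiAlgebra ℂ (Fin k) ℂ).compLinearMap
      fun _ => lp.evalₗ (fun _ : ℕ => ℂ) 1 j).map_update_add v i a b
    simp only [MultilinearMap.compLinearMap_apply, MultilinearMap.mkPiAlgebra_apply,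
      lp.evalₗ_apply] at h
    simp only [lp.coeFn_add, Pi.add_apply, ← mul_add, ← h]
  map_update_smul' v i c a := by
    ext j
    have h := ((MultilinearMap.mkPiAlgebra ℂ (Fin k) ℂ).compLinearMap
      fun _ => lp.evalₗ (fun _ : ℕ => ℂ) 1 j).map_update_smul v i c a
    simp only [MultilinearMap.compLinearMap_apply, MultilinearMap.mkPiAlgebra_apply,
      lp.evalₗ_apply] at h
    simp only [lp.coeFn_smul, Pi.smul_apply, h, smul_eq_mul, mul_left_comm]

variable {P}

theorem diagTerm_apply (y : lp (fun _ : ℕ => ℂ) 1) (k : ℕ)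
    (v : Fin k → lp (fun _ : ℕ => ℂ) 1) (j : ℕ) :
    diagTerm P y k v j = diagCoeff y k j * ∏ i, v i j := rfl

theorem norm_diagTerm_le_tsum (hPt : P ≠ ∞) (y : lp (fun _ : ℕ => ℂ) 1) (k : ℕ)
    (v : Fin k → lp (fun _ : ℕ => ℂ) 1) :
    ‖diagTerm P y k v‖ ≤ ∑' j, ‖diagCoeff y k j * ∏ i, v i j‖ := by
  have h := lp_norm_le_tsum hPt (diagTerm P y k v)
  simp only [diagTerm_apply] at h
  exact h (summable_norm_diagCoeff_mul_prod y k v)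

theorem norm_diagTerm_le (hPt : P ≠ ∞) (y : lp (fun _ : ℕ => ℂ) 1) (k : ℕ)
    (v : Fin k → lp (fun _ : ℕ => ℂ) 1) :
    ‖diagTerm P y k v‖ ≤ (∑' j, ‖diagCoeff y k j‖) * ∏ i, ‖v i‖ := by
  refine (norm_diagTerm_le_tsum hPt y k v).trans ?_
  rw [← tsum_mul_right]
  exact (summable_norm_diagCoeff_mul_prod y k v).tsum_le_tsum (norm_diagCoeff_mul_prod_le y k v)
    ((summable_norm_diagCoeff y k).mul_right _)

theorem norm_diagTerm_succ_le (hPt : P ≠ ∞) (y : lp (fun _ : ℕ => ℂ) 1) (k : ℕ) {C : ℝ}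
    (hC : ∀ j, ‖diagCoeff y (k + 1) j‖ ≤ C) (v : Fin (k + 1) → lp (fun _ : ℕ => ℂ) 1) :
    ‖diagTerm P y (k + 1) v‖ ≤ C * ∏ i, ‖v i‖ := by
  have hC0 : 0 ≤ C := (norm_nonneg _).trans (hC 0)
  refine (norm_diagTerm_le_tsum hPt y (k + 1) v).trans ?_
  have hle : ∀ j, ‖diagCoeff y (k + 1) j * ∏ i, v i j‖ ≤
      C * (∏ i : Fin k, ‖v i.succ‖) * ‖v 0 j‖ := fun j => by
    rw [norm_mul, norm_prod, Fin.prod_univ_succ, mul_assoc, mul_comm ‖v 0 j‖]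
    gcongr with i
    · exact hC j
    · exact lp.norm_apply_le_norm one_ne_zero _ _
  have hs := (summable_norm_lp_one (v 0)).mul_left (C * ∏ i : Fin k, ‖v i.succ‖)
  refine ((summable_norm_diagCoeff_mul_prod y (k + 1) v).tsum_le_tsum hle hs).trans_eq ?_
  rw [tsum_mul_left, tsum_norm_lp_one, Fin.prod_univ_succ, mul_assoc, mul_comm ‖v 0‖]

/-- The Taylor series of the diagonal map at `y`. -/
def diagSeries (hPt : P ≠ ∞) (y : lp (fun _ : ℕ => ℂ) 1) :
    FormalMultilinearSeries ℂ (lp (fun _ : ℕ => ℂ) 1) (lp (fun _ : ℕ => ℂ) P) := fun k =>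
  (diagTerm P y k).mkContinuous (∑' j, ‖diagCoeff y k j‖) (norm_diagTerm_le hPt y k)

theorem diagSeries_apply (hPt : P ≠ ∞) (y v : lp (fun _ : ℕ => ℂ) 1) (k j : ℕ) :
    diagSeries hPt y k (fun _ => v) j = diagCoeff y k j * v j ^ k := by
  change diagCoeff y k j * ∏ _i : Fin k, v j = _
  simp

variable (P) in
/-- The diagonal map `x ↦ (x j ^ slowDegree j)`. -/
def diagMap (x : lp (fun _ : ℕ => ℂ) 1) : lp (fun _ : ℕ => ℂ) P :=
  ⟨fun j => x j ^ slowDegree j, memℓp_of_summable_norm <| by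
    simpa [diagCoeff] using summable_norm_diagCoeff x 0⟩

theorem le_radius_diagSeries (hPt : P ≠ ∞) (y : lp (fun _ : ℕ => ℂ) 1) :
    ((1 / 4 : ℝ≥0) : ℝ≥0∞) ≤ (diagSeries hPt y).radius := by
  obtain ⟨C, hC⟩ := exists_norm_diagCoeff_mul_le y
  refine FormalMultilinearSeries.le_radius_of_bound _ (max C ‖diagSeries hPt y 0‖) fun k => ?_
  have hr : ((1 / 4 : ℝ≥0) : ℝ) = 1 / 4 := by norm_num
  rw [hr]
  rcases k with _ | k
  · simp
  · refine le_max_of_le_left ?_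
    have hC' : ∀ j, ‖diagCoeff y (k + 1) j‖ ≤ C / (1 / 4) ^ (k + 1) := fun j =>
      (le_div_iff₀ (by positivity)).2 (hC _ j)
    rw [← le_div_iff₀ (by positivity)]
    exact ContinuousMultilinearMap.opNorm_le_bound ((norm_nonneg _).trans (hC' 0))
      (norm_diagTerm_succ_le hPt y k hC')

theorem hasFPowerSeriesOnBall_diagMap (hPt : P ≠ ∞) (y : lp (fun _ : ℕ => ℂ) 1) :
    HasFPowerSeriesOnBall (diagMap P) (diagSeries hPt y) y ((1 / 4 : ℝ≥0) : ℝ≥0∞) where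
  r_le := le_radius_diagSeries hPt y
  r_pos := by norm_num
  hasSum {v} hv := by
    have hs := (diagSeries hPt y).hasSum (Metric.eball_subset_eball (le_radius_diagSeries hPt y) hv)
    convert hs
    ext j
    have h1 : HasSum (fun k => diagCoeff y k j * v j ^ k) ((diagSeries hPt y).sum v j) := by
      simp_rw [← diagSeries_apply hPt]
      exact hs.mapL (lp.evalCLM ℂ (fun _ : ℕ => ℂ) P j)
    refine HasSum.unique ?_ h1
    have h2 : (diagMap P (y + v)) j =
        ∑ k ∈ Finset.range (slowDegree j + 1), diagCoeff y k j * v j ^ k := by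
      change (y j + v j) ^ slowDegree j = _
      rw [add_comm, add_pow]
      exact Finset.sum_congr rfl fun k _ => by rw [diagCoeff]; ring
    rw [h2]
    refine hasSum_sum_of_ne_finset_zero fun k hk => ?_
    rw [diagCoeff, Nat.choose_eq_zero_of_lt (by simpa using hk)]
    simp

theorem taylorPoly_diagMap_apply (hPt : P ≠ ∞) (y v : lp (fun _ : ℕ => ℂ) 1) (k j : ℕ) :
    taylorPoly (diagMap P) y k v j = diagCoeff y k j * v j ^ k := by
  rw [taylorPoly, ← (hasFPowerSeriesOnBall_diagMap hPt y).factorial_smul v k,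
    ← Nat.cast_smul_eq_nsmul ℂ, smul_smul,
    inv_mul_cancel₀ (Nat.cast_ne_zero.2 k.factorial_ne_zero), one_smul, diagSeries_apply]

theorem isRelPCompact_taylorPoly_diagMap (hPt : P ≠ ∞) (y : lp (fun _ : ℕ => ℂ) 1) (k : ℕ) :
    IsRelPCompact 1 (taylorPoly (diagMap P) y k '' closedBall 0 1) := by
  refine isRelPCompact_of_norm_apply_le hPt (summable_norm_diagCoeff y k) ?_
  rintro _ ⟨v, hv, rfl⟩ j
  rw [taylorPoly_diagMap_apply hPt, norm_mul, norm_pow]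
  refine mul_le_of_le_one_right (norm_nonneg _) (pow_le_one₀ (norm_nonneg _) ?_)
  exact (lp.norm_apply_le_norm one_ne_zero v j).trans (by simpa using hv)

end Diagonal

/-- Every ball contains a point whose `j`-th coordinate is bounded below by half the radius. -/
theorem exists_mem_ball_le_norm_apply (y : lp (fun _ : ℕ => ℂ) 1) {ε : ℝ} (hε : 0 < ε) (j : ℕ) :
    ∃ v ∈ ball y ε, ε / 2 ≤ ‖v j‖ := by
  set t : lp (fun _ : ℕ => ℂ) 1 := lp.single 1 j ((ε / 2 : ℝ) : ℂ) with ht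
  have hnorm : ‖t‖ = ε / 2 := by
    rw [ht, lp.norm_single (E := fun _ : ℕ => ℂ) zero_lt_one, Complex.norm_real,
      Real.norm_of_nonneg (by positivity)]
  have htj : ‖t j‖ = ε / 2 := by
    rw [ht, lp.single_apply_self, Complex.norm_real, Real.norm_of_nonneg (by positivity)]
  by_contra! h
  have h1 := h (y + t) (by rw [mem_ball_iff_norm, add_sub_cancel_left, hnorm]; linarith)
  have h2 := h (y - t) (by rw [mem_ball_iff_norm, sub_sub_cancel_left, norm_neg, hnorm]; linarith)
  have h3 := norm_sub_le ((y + t) j) ((y - t) j)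
  have h4 : (y + t) j - (y - t) j = 2 * t j := by
    simp only [lp.coeFn_add, lp.coeFn_sub, Pi.add_apply, Pi.sub_apply]
    ring
  rw [h4, norm_mul, htj, Complex.norm_two] at h3
  linarith

theorem not_pCompactAt_diagMap (p : ℝ) [hp : Fact (1 ≤ p)] (y : lp (fun _ : ℕ => ℂ) 1) :
    ¬ PCompactAt p (diagMap (ENNReal.ofReal p)) y := by
  rintro ⟨V, hV, hK⟩
  obtain ⟨ε, hε, hεV⟩ := Metric.mem_nhds_iff.1 hV
  obtain ⟨S, hS, hle⟩ := hK.exists_summable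
  have hp0 : 0 ≤ p := by linarith [hp.out]
  refine not_summable_pow_slowDegree (δ := (ε / 2) ^ p) (by positivity)
    (Summable.of_nonneg_of_le (fun j => by positivity) (fun j => ?_) hS)
  obtain ⟨v, hv, hvj⟩ := exists_mem_ball_le_norm_apply y hε j
  refine le_trans ?_ (hle _ ⟨v, hεV hv, rfl⟩ j)
  change _ ≤ ‖v j ^ slowDegree j‖ ^ p
  rw [norm_pow, ← Real.rpow_natCast, ← Real.rpow_mul (by positivity), mul_comm,
    Real.rpow_mul (by positivity), Real.rpow_natCast]
  gcongr

/-- **Example 3.7.** For every `1 ≤ p < ∞` there exists an entire function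
`f : ℓ₁ → ℓ_p` such that every polynomial `P_mf(y)` of the Taylor series expansion of `f`
at any `y ∈ ℓ₁` is `1`-compact (hence `r`-compact for all `1 ≤ r < ∞`), but `f` fails to be
`p`-compact at every point `y ∈ ℓ₁`. -/
theorem statement9 (p : ℝ) [hp : Fact (1 ≤ p)] :
    ∃ f : lp (fun _ : ℕ => ℂ) 1 → lp (fun _ : ℕ => ℂ) (ENNReal.ofReal p),
      (∀ x, AnalyticAt ℂ f x) ∧
      (∀ (y : lp (fun _ : ℕ => ℂ) 1) (m : ℕ),
        IsRelPCompact 1 (taylorPoly f y m '' closedBall 0 1) ∧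
        ∀ r : ℝ, 1 ≤ r → IsRelPCompact r (taylorPoly f y m '' closedBall 0 1)) ∧
      (∀ y : lp (fun _ : ℕ => ℂ) 1, ¬ PCompactAt p f y) :=
  ⟨diagMap (ENNReal.ofReal p),
    fun x => (hasFPowerSeriesOnBall_diagMap ENNReal.ofReal_ne_top x).analyticAt,
    fun y m => ⟨isRelPCompact_taylorPoly_diagMap ENNReal.ofReal_ne_top y m,
      fun _ hr => (isRelPCompact_taylorPoly_diagMap ENNReal.ofReal_ne_top y m).of_one hr⟩,
    not_pCompactAt_diagMap p⟩

end
end
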